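/- arXiv:1705.05298 — 3 statements merged into one kernel-verified Lean document; each statement's English description precedes it below -/
import Mathlib

section
/- For any n ≥ 1, Σ_{σ ∈ S_n(231)} q^{mad(σ)} = Σ_{σ ∈ S_n(321)} q^{inv(σ)}. -/
namespace MahonianStats

open Finset

/-- The value sequence of a permutation of `{1,…,n}`: position `i` (0-indexed)
carries the value `σ(i+1) ∈ {1,…,n}`; positions `≥ n` carry the junk value `0`. -/
def pf {n : ℕ} (σ : Equiv.Perm (Fin n)) : ℕ → ℕ :=
  fun i => if h : i < n then ((σ ⟨i, h⟩ : Fin n) : ℕ) + 1 else 0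

/-- The value sequence of a list (junk value `0` out of range). -/
def lf (l : List ℕ) : ℕ → ℕ := fun i => l.getD i 0

/-- Descent positions (0-indexed). -/
def desSet (n : ℕ) (f : ℕ → ℕ) : Finset ℕ :=
  (range (n - 1)).filter fun i => f (i + 1) < f i

def des (n : ℕ) (f : ℕ → ℕ) : ℕ := (desSet n f).card

/-- Major index: sum of (1-indexed) descent positions. -/
def maj (n : ℕ) (f : ℕ → ℕ) : ℕ := ∑ i ∈ desSet n f, (i + 1)

/-- Occurrences of the vincular pattern (1-32). -/
def p1_32 (n : ℕ) (f : ℕ → ℕ) : ℕ :=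
  ((range n ×ˢ range n).filter fun p =>
    p.1 < p.2 ∧ p.2 + 1 < n ∧ f p.1 < f (p.2 + 1) ∧ f (p.2 + 1) < f p.2).card

/-- Occurrences of the vincular pattern (31-2). -/
def p31_2 (n : ℕ) (f : ℕ → ℕ) : ℕ :=
  ((range n ×ˢ range n).filter fun p =>
    p.1 + 1 < p.2 ∧ f (p.1 + 1) < f p.2 ∧ f p.2 < f p.1).card

/-- Occurrences of the vincular pattern (32-1). -/
def p32_1 (n : ℕ) (f : ℕ → ℕ) : ℕ :=
  ((range n ×ˢ range n).filter fun p =>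
    p.1 + 1 < p.2 ∧ f p.2 < f (p.1 + 1) ∧ f (p.1 + 1) < f p.1).card

/-- Occurrences of the vincular pattern (21-3). -/
def p21_3 (n : ℕ) (f : ℕ → ℕ) : ℕ :=
  ((range n ×ˢ range n).filter fun p =>
    p.1 + 1 < p.2 ∧ f (p.1 + 1) < f p.1 ∧ f p.1 < f p.2).card

/-- Occurrences of the vincular pattern (3-21). -/
def p3_21 (n : ℕ) (f : ℕ → ℕ) : ℕ :=
  ((range n ×ˢ range n).filter fun p =>
    p.1 < p.2 ∧ p.2 + 1 < n ∧ f (p.2 + 1) < f p.2 ∧ f p.2 < f p.1).card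

/-- Occurrences of the vincular pattern (13-2). -/
def p13_2 (n : ℕ) (f : ℕ → ℕ) : ℕ :=
  ((range n ×ˢ range n).filter fun p =>
    p.1 + 1 < p.2 ∧ f p.1 < f p.2 ∧ f p.2 < f (p.1 + 1)).card

/-- Occurrences of the vincular pattern (2-13). -/
def p2_13 (n : ℕ) (f : ℕ → ℕ) : ℕ :=
  ((range n ×ˢ range n).filter fun p =>
    p.1 < p.2 ∧ p.2 + 1 < n ∧ f p.2 < f p.1 ∧ f p.1 < f (p.2 + 1)).card

/-- Occurrences of the vincular pattern (2-31). -/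
def p2_31 (n : ℕ) (f : ℕ → ℕ) : ℕ :=
  ((range n ×ˢ range n).filter fun p =>
    p.1 < p.2 ∧ p.2 + 1 < n ∧ f (p.2 + 1) < f p.1 ∧ f p.1 < f p.2).card

/-- Number of inversions. -/
def invp (n : ℕ) (f : ℕ → ℕ) : ℕ :=
  ((range n ×ˢ range n).filter fun p => p.1 < p.2 ∧ f p.2 < f p.1).card

def mak (n : ℕ) (f : ℕ → ℕ) : ℕ := p1_32 n f + p31_2 n f + p32_1 n f + des n f

def mad (n : ℕ) (f : ℕ → ℕ) : ℕ := 2 * p2_31 n f + p31_2 n f + des n f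

def Av123 (n : ℕ) (f : ℕ → ℕ) : Prop :=
  ¬ ∃ i j k, i < j ∧ j < k ∧ k < n ∧ f i < f j ∧ f j < f k
def Av132 (n : ℕ) (f : ℕ → ℕ) : Prop :=
  ¬ ∃ i j k, i < j ∧ j < k ∧ k < n ∧ f i < f k ∧ f k < f j
def Av213 (n : ℕ) (f : ℕ → ℕ) : Prop :=
  ¬ ∃ i j k, i < j ∧ j < k ∧ k < n ∧ f j < f i ∧ f i < f k
def Av231 (n : ℕ) (f : ℕ → ℕ) : Prop :=
  ¬ ∃ i j k, i < j ∧ j < k ∧ k < n ∧ f k < f i ∧ f i < f j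
def Av312 (n : ℕ) (f : ℕ → ℕ) : Prop :=
  ¬ ∃ i j k, i < j ∧ j < k ∧ k < n ∧ f j < f k ∧ f k < f i
def Av321 (n : ℕ) (f : ℕ → ℕ) : Prop :=
  ¬ ∃ i j k, i < j ∧ j < k ∧ k < n ∧ f k < f j ∧ f j < f i

/-- `f` restricted to `{0,…,n-1}` is a bijection onto `{1,…,n}`. -/
structure IsW (n : ℕ) (f : ℕ → ℕ) : Prop where
  pos : ∀ i, i < n → 1 ≤ f i
  le : ∀ i, i < n → f i ≤ n
  inj : ∀ i j, i < n → j < n → f i = f j → i = j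
  surj : ∀ v, 1 ≤ v → v ≤ n → ∃ i, i < n ∧ f i = v

theorem pf_isW {n : ℕ} (σ : Equiv.Perm (Fin n)) : IsW n (pf σ) := by
  refine ⟨?_, ?_, ?_, ?_⟩
  · intro i hi; simp [pf, hi]
  · intro i hi
    have := (σ ⟨i, hi⟩).isLt
    simp only [pf, hi, dif_pos]; omega
  · intro i j hi hj h
    simp only [pf, hi, hj, dif_pos] at h
    have h2 : σ ⟨i, hi⟩ = σ ⟨j, hj⟩ := Fin.ext (by omega)
    have := σ.injective h2
    simpa using this
  · intro v h1 h2
    refine ⟨(σ.symm ⟨v - 1, by omega⟩ : Fin n), (σ.symm ⟨v - 1, by omega⟩ : Fin n).isLt, ?_⟩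
    simp [pf]; omega

theorem pf_ext {n : ℕ} {σ τ : Equiv.Perm (Fin n)} (h : ∀ i, i < n → pf σ i = pf τ i) : σ = τ := by
  ext ⟨i, hi⟩
  have := h i hi
  simp only [pf, hi, dif_pos] at this
  omega

theorem exists_perm {n : ℕ} {f : ℕ → ℕ} (h1 : ∀ i, i < n → 1 ≤ f i) (h2 : ∀ i, i < n → f i ≤ n)
    (h3 : ∀ i j, i < n → j < n → f i = f j → i = j) :
    ∃ σ : Equiv.Perm (Fin n), ∀ i, i < n → pf σ i = f i := by
  let g : Fin n → Fin n := fun i => ⟨f i - 1, by have := h1 i i.2; have := h2 i i.2; omega⟩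
  have hg : Function.Injective g := by
    intro i j hij
    have h4 : f i - 1 = f j - 1 := congrArg Fin.val hij
    have := h1 i i.2
    have := h1 j j.2
    exact Fin.ext (h3 i j i.2 j.2 (by omega))
  refine ⟨Equiv.ofBijective g (Finite.injective_iff_bijective.1 hg), ?_⟩
  intro i hi
  have := h1 i hi
  simp [pf, hi, g]; omega

/-- Number of positions carrying a value below `m`. -/
theorem IsW.card_lt {n : ℕ} {f : ℕ → ℕ} (h : IsW n f) (a b : ℕ) (hb : b ≤ n + 1) :
    ((range n).filter fun j => a < f j ∧ f j < b).card = b - a - 1 := by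
  rw [← Nat.card_Ioo]
  apply Finset.card_bij (fun j _ => f j)
  · intro j hj; simp at hj ⊢; omega
  · intro i hi j hj e; simp at hi hj; exact h.inj i j hi.1 hj.1 e
  · intro v hv
    simp at hv
    obtain ⟨i, hi, e⟩ := h.surj v (by omega) (by omega)
    exact ⟨i, by simp; omega, e⟩

/-- Pairs of sets of size `k` with the dominance condition. -/
def PP (n : ℕ) : Finset (Finset ℕ × Finset ℕ) :=
  ((Icc 1 n).powerset ×ˢ (Icc 1 n).powerset).filter fun p =>
    p.1.card = p.2.card ∧
      ∀ x, x ≤ n → (p.2.filter fun v => v ≤ x).card ≤ (p.1.filter fun i => i < x).card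

def wt (p : Finset ℕ × Finset ℕ) : ℕ := ∑ v ∈ p.2, v - ∑ i ∈ p.1, i

theorem mem_PP {n : ℕ} {S : Finset ℕ} {a b : ℕ → ℕ} (ha : Set.InjOn a S) (hb : Set.InjOn b S)
    (h1 : ∀ p ∈ S, 1 ≤ a p) (h2 : ∀ p ∈ S, b p ≤ n) (h3 : ∀ p ∈ S, a p < b p) :
    (S.image a, S.image b) ∈ PP n ∧ wt (S.image a, S.image b) = ∑ p ∈ S, (b p - a p) := by
  constructor
  · simp only [PP, mem_filter, mem_product, mem_powerset]
    refine ⟨⟨?_, ?_⟩, ?_, ?_⟩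
    · intro x hx
      obtain ⟨p, hp, rfl⟩ := mem_image.1 hx
      have := h1 p hp; have := h2 p hp; have := h3 p hp
      simp; omega
    · intro x hx
      obtain ⟨p, hp, rfl⟩ := mem_image.1 hx
      have := h1 p hp; have := h2 p hp; have := h3 p hp
      simp; omega
    · rw [card_image_of_injOn ha, card_image_of_injOn hb]
    · intro x _
      rw [filter_image, filter_image, card_image_of_injOn (hb.mono (coe_subset.2 (filter_subset _ _))),
        card_image_of_injOn (ha.mono (coe_subset.2 (filter_subset _ _)))]
      apply card_le_card
      intro p hp
      simp at hp ⊢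
      have := h3 p hp.1
      exact ⟨hp.1, by omega⟩
  · simp only [wt]
    rw [sum_image ha, sum_image hb]
    have : ∑ p ∈ S, b p = ∑ p ∈ S, (b p - a p) + ∑ p ∈ S, a p := by
      rw [← sum_add_distrib]
      apply sum_congr rfl
      intro p hp
      have := h3 p hp; omega
    omega

theorem card_prod_filter (n : ℕ) (P : ℕ × ℕ → Prop) [DecidablePred P] :
    ((range n ×ˢ range n).filter P).card =
      ∑ i ∈ range n, ((range n).filter fun j => P (i, j)).card := by
  simp only [card_filter, sum_product]

/-! ### 231-avoiding permutations -/

def mapA (n : ℕ) (f : ℕ → ℕ) : Finset ℕ × Finset ℕ :=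
  ((desSet n f).image (fun p => f (p + 1)), (desSet n f).image f)

theorem mem_desSet {n : ℕ} {f : ℕ → ℕ} {p : ℕ} :
    p ∈ desSet n f ↔ p + 1 < n ∧ f (p + 1) < f p := by
  simp [desSet]; omega

theorem mapA_mem {n : ℕ} {f : ℕ → ℕ} (h : IsW n f) :
    mapA n f ∈ PP n ∧ wt (mapA n f) = ∑ p ∈ desSet n f, (f p - f (p + 1)) := by
  apply mem_PP
  · intro p hp q hq e
    rw [mem_coe, mem_desSet] at hp hq
    have := h.inj (p + 1) (q + 1) (by omega) (by omega) e
    omega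
  · intro p hp q hq e
    rw [mem_coe, mem_desSet] at hp hq
    exact h.inj p q (by omega) (by omega) e
  · intro p hp; rw [mem_desSet] at hp; exact h.pos _ hp.1
  · intro p hp; rw [mem_desSet] at hp; exact h.le _ (by omega)
  · intro p hp; rw [mem_desSet] at hp; exact hp.2

theorem mad_eq {n : ℕ} {f : ℕ → ℕ} (h : IsW n f) (hA : Av231 n f) :
    mad n f = ∑ p ∈ desSet n f, (f p - f (p + 1)) := by
  have h0 : p2_31 n f = 0 := by
    rw [p2_31, card_eq_zero, filter_eq_empty_iff]
    rintro ⟨i, j⟩ _ ⟨h1, h2, h3, h4⟩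
    exact hA ⟨i, j, j + 1, h1, by simp, h2, h3, h4⟩
  have h1 : p31_2 n f = ∑ p ∈ desSet n f, (f p - f (p + 1) - 1) := by
    rw [p31_2, card_prod_filter]
    symm
    have hs : desSet n f ⊆ range n := by
      intro p hp; rw [mem_desSet] at hp; simp; omega
    rw [← sum_subset hs (f := fun i => ((range n).filter fun j =>
      i + 1 < j ∧ f (i + 1) < f j ∧ f j < f i).card)]
    · apply sum_congr rfl
      intro p hp
      rw [mem_desSet] at hp
      rw [← h.card_lt (f (p + 1)) (f p) (by have := h.le p (by omega); omega)]
      congr 1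
      apply filter_congr
      intro j hj
      simp at hj
      constructor
      · rintro ⟨h1, h2⟩
        refine ⟨?_, h1, h2⟩
        by_contra hc
        have h5 : j ≠ p := by rintro rfl; omega
        have h6 : j ≠ p + 1 := by rintro rfl; omega
        exact hA ⟨j, p, p + 1, by omega, by omega, hp.1, h1, h2⟩
      · tauto
    · intro p _ hp
      rw [card_eq_zero, filter_eq_empty_iff]
      rintro j hj ⟨h1, h2, h3⟩
      simp at hj
      exact hp (mem_desSet.2 ⟨by omega, by omega⟩)
  rw [mad, h0, h1, des, card_eq_sum_ones, mul_zero, zero_add, ← sum_add_distrib]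
  apply sum_congr rfl
  intro p hp
  rw [mem_desSet] at hp
  omega

theorem mapA_step {n : ℕ} {f g : ℕ → ℕ} (hf : IsW n f) (hg : IsW n g) (hA : Av231 n f)
    (hB : Av231 n g) (e : mapA n f = mapA n g) (p : ℕ) (hp : p < n)
    (ih : ∀ q, p < q → q < n → f q = g q) :
    (p ∈ desSet n f → p ∈ desSet n g) ∧ (p ∈ desSet n g → p ∈ desSet n f → f p ≤ g p) ∧
    (p ∉ desSet n f → p ∉ desSet n g → f p ≤ g p) := by
  have e1 := congrArg Prod.fst e
  have e2 := congrArg Prod.snd e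
  simp only [mapA] at e1 e2
  refine ⟨?_, ?_, ?_⟩
  · intro h
    have h1 : f (p + 1) ∈ (desSet n f).image (fun p => f (p + 1)) := mem_image_of_mem (fun p => f (p + 1)) h
    rw [e1] at h1
    obtain ⟨q, hq, hq2⟩ := mem_image.1 h1
    rw [mem_desSet] at h
    rw [ih (p + 1) (by omega) h.1] at hq2
    have hq' := hq
    rw [mem_desSet] at hq
    have := hg.inj _ _ hq.1 h.1 hq2
    have : q = p := by omega
    subst this
    exact hq'
  · intro h1 h2
    rw [mem_desSet] at h1 h2
    obtain ⟨q, hq, hq2⟩ := hf.surj (g p) (hg.pos p hp) (hg.le p hp)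
    have h3 : q ≤ p := by
      by_contra hc
      have := ih q (by omega) hq
      have := hg.inj q p hq hp (by omega)
      omega
    have h4 := ih (p + 1) (by omega) h1.1
    by_contra hc
    have h5 : q ≠ p := by rintro rfl; omega
    exact hA ⟨q, p, p + 1, by omega, by omega, h1.1, by omega, by omega⟩
  · intro h1 h2
    obtain ⟨q, hq, hq2⟩ := hg.surj (f p) (hf.pos p hp) (hf.le p hp)
    have h3 : q ≤ p := by
      by_contra hc
      have := ih q (by omega) hq
      have := hf.inj q p hq hp (by omega)
      omega
    have h4 : q ∉ desSet n g := by
      intro h5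
      have h6 : g q ∈ (desSet n g).image g := mem_image_of_mem g h5
      rw [← e2, hq2] at h6
      obtain ⟨r, hr, hr2⟩ := mem_image.1 h6
      have hr' := mem_desSet.1 hr
      have := hf.inj r p (by omega) hp hr2
      subst this
      exact h1 hr
    rw [mem_desSet] at h4
    by_contra hc
    have h5 : q ≠ p := by rintro rfl; omega
    have h6 : g (q + 1) ≠ g q := by
      intro h; have := hg.inj _ _ (by omega) hq h; omega
    have h7 : g q < g (q + 1) := by
      by_contra h; exact h4 ⟨by omega, by omega⟩
    have h8 : q + 1 ≠ p := by rintro rfl; omega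
    exact hB ⟨q, q + 1, p, by omega, by omega, hp, by omega, h7⟩

theorem mapA_inj {n : ℕ} {f g : ℕ → ℕ} (hf : IsW n f) (hg : IsW n g) (hA : Av231 n f)
    (hB : Av231 n g) (e : mapA n f = mapA n g) : ∀ i, i < n → f i = g i := by
  have key : ∀ m p, p < n → n - 1 - p = m → f p = g p := by
    intro m
    induction m using Nat.strong_induction_on with
    | _ m IH =>
      intro p hp hm
      have ih : ∀ q, p < q → q < n → f q = g q := fun q h1 h2 =>
        IH (n - 1 - q) (by omega) q h2 rfl
      obtain ⟨a1, a2, a3⟩ := mapA_step hf hg hA hB e p hp ih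
      obtain ⟨b1, b2, b3⟩ := mapA_step hg hf hB hA e.symm p hp (fun q h1 h2 => (ih q h1 h2).symm)
      by_cases h : p ∈ desSet n f
      · exact le_antisymm (a2 (a1 h) h) (b2 h (a1 h))
      · have h' : p ∉ desSet n g := fun h2 => h (b1 h2)
        exact le_antisymm (a3 h h') (b3 h' h)
  intro i hi
  exact key _ i hi rfl

/-! ### 321-avoiding permutations -/

def excSet (n : ℕ) (f : ℕ → ℕ) : Finset ℕ := (range n).filter fun i => i + 1 < f i

theorem mem_excSet {n : ℕ} {f : ℕ → ℕ} {p : ℕ} : p ∈ excSet n f ↔ p < n ∧ p + 1 < f p := by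
  simp [excSet]

def mapB (n : ℕ) (f : ℕ → ℕ) : Finset ℕ × Finset ℕ :=
  ((excSet n f).image (fun p => p + 1), (excSet n f).image f)

theorem mapB_mem {n : ℕ} {f : ℕ → ℕ} (h : IsW n f) :
    mapB n f ∈ PP n ∧ wt (mapB n f) = ∑ p ∈ excSet n f, (f p - (p + 1)) := by
  apply mem_PP
  · intro p hp q hq e
    simpa using e
  · intro p hp q hq e
    rw [mem_coe, mem_excSet] at hp hq
    exact h.inj p q (by omega) (by omega) e
  · intro p hp; omega
  · intro p hp; rw [mem_excSet] at hp; exact h.le _ (by omega)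
  · intro p hp; rw [mem_excSet] at hp; exact hp.2

/-- After an excedance there is a smaller value. -/
theorem exc_later {n : ℕ} {f : ℕ → ℕ} (h : IsW n f) {j : ℕ} (hj : j < n) (hx : j + 1 < f j) :
    ∃ k, j < k ∧ k < n ∧ f k < f j := by
  by_contra hc
  push Not at hc
  have h1 := h.card_lt 0 (f j) (by have := h.le j hj; omega)
  have h2 : ((range n).filter fun i => 0 < f i ∧ f i < f j) ⊆ range j := by
    intro k hk
    simp at hk ⊢
    by_contra hh
    have h5 : k ≠ j := by rintro rfl; omega
    have := hc k (by omega) hk.1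
    omega
  have := card_le_card h2
  simp at this h1
  omega

/-- If a non-excedance is followed by a smaller value, it is preceded by a larger one. -/
theorem nonexc_earlier {n : ℕ} {f : ℕ → ℕ} (h : IsW n f) {i j : ℕ} (hij : i < j) (hj : j < n)
    (hx : f i ≤ i + 1) (hlt : f j < f i) : ∃ k, k < i ∧ f i < f k := by
  by_contra hc
  push Not at hc
  have h1 := h.card_lt 0 (f i) (by have := h.le i (by omega); omega)
  have h2 : insert j (range i) ⊆ ((range n).filter fun k => 0 < f k ∧ f k < f i) := by
    intro k hk
    simp at hk ⊢
    rcases hk with rfl | hk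
    · exact ⟨hj, h.pos _ hj, hlt⟩
    · have h3 := hc k hk
      have h4 := h.pos k (by omega)
      have h5 : f k ≠ f i := fun e => by
        have := h.inj k i (by omega) (by omega) e; omega
      omega
  have := card_le_card h2
  rw [card_insert_of_notMem (by simp; omega)] at this
  simp at this h1
  omega

theorem nonexc_mono {n : ℕ} {f : ℕ → ℕ} (h : IsW n f) (hA : Av321 n f) {i j : ℕ} (hij : i < j)
    (hj : j < n) (hx : f i ≤ i + 1) : f i ≤ f j := by
  by_contra hc
  obtain ⟨k, hk, hk2⟩ := nonexc_earlier h hij hj hx (by omega)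
  exact hA ⟨k, i, j, hk, hij, hj, by omega, hk2⟩

theorem exc_mono {n : ℕ} {f : ℕ → ℕ} (h : IsW n f) (hA : Av321 n f) {i j : ℕ} (hij : i < j)
    (hj : j < n) (hx : j + 1 < f j) : f i ≤ f j := by
  by_contra hc
  obtain ⟨k, hk, hk1, hk2⟩ := exc_later h hj hx
  exact hA ⟨i, j, k, hij, hk, hk1, hk2, by omega⟩

theorem inv_eq {n : ℕ} {f : ℕ → ℕ} (h : IsW n f) (hA : Av321 n f) :
    invp n f = ∑ p ∈ excSet n f, (f p - (p + 1)) := by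
  rw [invp, card_prod_filter]
  symm
  have hs : excSet n f ⊆ range n := filter_subset _ _
  rw [← sum_subset hs (f := fun i => ((range n).filter fun j => i < j ∧ f j < f i).card)]
  · apply sum_congr rfl
    intro p hp
    rw [mem_excSet] at hp
    have h1 := h.card_lt 0 (f p) (by have := h.le p (by omega); omega)
    have h2 : ((range n).filter fun j => 0 < f j ∧ f j < f p) =
        ((range n).filter fun j => p < j ∧ f j < f p) ∪ range p := by
      ext j
      simp only [mem_filter, mem_union, mem_range]
      constructor
      · rintro ⟨a, b, c⟩
        have h5 : j ≠ p := by rintro rfl; omega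
        omega
      · rintro (⟨a, b, c⟩ | a)
        · exact ⟨a, h.pos _ a, c⟩
        · refine ⟨by omega, h.pos _ (by omega), ?_⟩
          have h3 := exc_mono h hA a hp.1 hp.2
          have h5 : f j ≠ f p := fun e => by
            have := h.inj j p (by omega) (by omega) e; omega
          omega
    rw [h2, card_union_of_disjoint] at h1
    · simp at h1
      omega
    · rw [disjoint_left]
      intro j hj hj2
      simp at hj hj2
      omega
  · intro p hpn hp
    rw [card_eq_zero, filter_eq_empty_iff]
    rintro j hj ⟨h1, h2⟩
    simp at hj hpn
    rw [mem_excSet] at hp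
    have := nonexc_mono h hA h1 hj (by omega)
    omega

theorem mapB_step {n : ℕ} {f g : ℕ → ℕ} (hf : IsW n f) (hg : IsW n g)
    (hB : Av321 n g) (e : mapB n f = mapB n g) (p : ℕ) (hp : p < n)
    (ih : ∀ q, q < p → f q = g q) : g p ≤ f p := by
  have e1 := congrArg Prod.fst e
  have e2 := congrArg Prod.snd e
  simp only [mapB] at e1 e2
  have e1' : excSet n f = excSet n g := image_injective (add_left_injective 1) e1
  obtain ⟨q, hq, hq2⟩ := hg.surj (f p) (hf.pos p hp) (hf.le p hp)
  have h3 : p ≤ q := by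
    by_contra hc
    have := ih q (by omega)
    have := hf.inj q p hq hp (by omega)
    omega
  rcases h3.eq_or_lt with rfl | h3
  · omega
  have key : q ∈ excSet n g ↔ p ∈ excSet n f := by
    constructor
    · intro hh
      have h6 : g q ∈ (excSet n g).image g := mem_image_of_mem g hh
      rw [← e2, hq2] at h6
      obtain ⟨r, hr, hr2⟩ := mem_image.1 h6
      have hr' := mem_excSet.1 hr
      have := hf.inj r p (by omega) hp hr2
      subst this
      exact hr
    · intro hh
      have h6 : f p ∈ (excSet n f).image f := mem_image_of_mem f hh
      rw [e2, ← hq2] at h6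
      obtain ⟨r, hr, hr2⟩ := mem_image.1 h6
      have hr' := mem_excSet.1 hr
      have := hg.inj r q (by omega) hq hr2
      subst this
      exact hr
  by_cases hx : p ∈ excSet n f
  · have := mem_excSet.1 (key.2 hx)
    rw [← hq2]
    exact exc_mono hg hB h3 hq this.2
  · have hx' := hx
    rw [e1', mem_excSet] at hx'
    rw [← hq2]
    exact nonexc_mono hg hB h3 hq (by omega)

theorem mapB_inj {n : ℕ} {f g : ℕ → ℕ} (hf : IsW n f) (hg : IsW n g) (hA : Av321 n f)
    (hB : Av321 n g) (e : mapB n f = mapB n g) : ∀ i, i < n → f i = g i := by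
  intro i
  induction i using Nat.strong_induction_on with
  | _ m IH =>
    intro hm
    have ih : ∀ q, q < m → f q = g q := fun q h => IH q h (by omega)
    exact le_antisymm (mapB_step hg hf hA e.symm m hm (fun q h => (ih q h).symm))
      (mapB_step hf hg hB e m hm ih)

theorem exists_mono (S T : Finset ℕ) (h : S.card = T.card) :
    ∃ g : ℕ → ℕ, StrictMonoOn g S ∧ S.image g = T := by
  classical
  let e := (S.orderIsoOfFin h).symm.trans (T.orderIsoOfFin rfl)
  let g : ℕ → ℕ := fun x => if hx : x ∈ S then (e ⟨x, hx⟩ : ℕ) else 0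
  have hg : ∀ x (hx : x ∈ S), g x = e ⟨x, hx⟩ := fun x hx => by simp [g, hx]
  refine ⟨g, ?_, ?_⟩
  · intro x hx y hy hxy
    rw [hg x hx, hg y hy]
    have : e ⟨x, hx⟩ < e ⟨y, hy⟩ := e.strictMono hxy
    exact this
  · ext t
    simp only [mem_image]
    constructor
    · rintro ⟨x, hx, rfl⟩
      rw [hg x hx]; exact (e ⟨x, hx⟩).2
    · intro ht
      refine ⟨e.symm ⟨t, ht⟩, (e.symm ⟨t, ht⟩).2, ?_⟩
      rw [hg _ (e.symm ⟨t, ht⟩).2]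
      simp

theorem mono_count {S : Finset ℕ} {g : ℕ → ℕ} (h : StrictMonoOn g S) {i : ℕ} (hi : i ∈ S) :
    ((S.image g).filter fun v => v ≤ g i).card = (S.filter fun s => s ≤ i).card := by
  rw [filter_image, card_image_of_injOn (h.injOn.mono (coe_subset.2 (filter_subset _ _)))]
  congr 1
  apply filter_congr
  intro s hs
  exact h.le_iff_le hs hi

theorem compl_count {n : ℕ} {I : Finset ℕ} (hI : I ⊆ Icc 1 n) {i : ℕ} (hi : i ≤ n) :
    ((Icc 1 n \ I).filter fun s => s ≤ i).card + (I.filter fun s => s ≤ i).card = i := by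
  rw [← card_union_of_disjoint]
  · have : ((Icc 1 n \ I).filter fun s => s ≤ i) ∪ (I.filter fun s => s ≤ i) = Icc 1 i := by
      ext x
      have := @hI x
      simp only [mem_union, mem_filter, mem_sdiff, mem_Icc] at this ⊢
      by_cases hx : x ∈ I
      · have := this hx; simp [hx]; omega
      · simp [hx]; omega
    rw [this]; simp
  · rw [disjoint_left]
    intro x hx hx2
    simp at hx hx2
    exact hx.1.2 hx2.1

theorem mapB_surj {n : ℕ} {q : Finset ℕ × Finset ℕ} (hq : q ∈ PP n) :
    ∃ σ : Equiv.Perm (Fin n), Av321 n (pf σ) ∧ mapB n (pf σ) = q := by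
  obtain ⟨I, V⟩ := q
  simp only [PP, mem_filter, mem_product, mem_powerset] at hq
  obtain ⟨⟨hI, hV⟩, hc, hd⟩ := hq
  obtain ⟨g, hg, hgi⟩ := exists_mono I V hc
  obtain ⟨k, hk, hki⟩ := exists_mono (Icc 1 n \ I) (Icc 1 n \ V) (by
    rw [card_sdiff_of_subset hI, card_sdiff_of_subset hV, hc])
  have gV : ∀ x ∈ I, g x ∈ V := fun x hx => hgi ▸ mem_image_of_mem g hx
  have kV : ∀ x ∈ Icc 1 n \ I, k x ∈ Icc 1 n \ V := fun x hx => hki ▸ mem_image_of_mem k hx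
  have gex : ∀ x ∈ I, x < g x := by
    intro x hx
    by_contra hc
    have h1 := mono_count hg hx
    rw [hgi] at h1
    have h2 := hd (g x) (by have := hV (gV x hx); simp at this; omega)
    have h3 : (I.filter fun i => i < g x) ⊂ (I.filter fun s => s ≤ x) := by
      rw [Finset.ssubset_iff_of_subset]
      · exact ⟨x, by simp [hx], by simp; omega⟩
      · intro y hy; simp at hy ⊢; exact ⟨hy.1, by omega⟩
    have := card_lt_card h3
    omega
  have kex : ∀ x ∈ Icc 1 n \ I, k x ≤ x := by
    intro x hx
    by_contra hc
    have h1 := mono_count hk hx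
    rw [hki] at h1
    have hkx := kV x hx
    have hx' := hx
    rw [mem_sdiff, mem_Icc] at hkx hx'
    have h2 := hd (k x) hkx.1.2
    have h3 := compl_count hI (i := x) hx'.1.2
    have h4 := compl_count hV (i := k x) hkx.1.2
    have h5 : (I.filter fun i => i < k x) ⊆ (I.filter fun s => s ≤ x) ∪ Ioo x (k x) := by
      intro y hy
      simp only [mem_filter, mem_union, mem_Ioo] at hy ⊢
      by_cases hyx : y ≤ x
      · exact Or.inl ⟨hy.1, hyx⟩
      · exact Or.inr (by omega)
    have h6 := (card_le_card h5).trans (card_union_le _ _)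
    simp only [Nat.card_Ioo] at h6
    omega
  let f : ℕ → ℕ := fun i => if i + 1 ∈ I then g (i + 1) else k (i + 1)
  have mem' : ∀ i, i < n → i + 1 ∉ I → i + 1 ∈ Icc 1 n \ I := fun i hi h => by
    simp [h]; omega
  have f1 : ∀ i, i + 1 ∈ I → f i = g (i + 1) := fun i h => by simp [f, h]
  have f2 : ∀ i, i + 1 ∉ I → f i = k (i + 1) := fun i h => by simp [f, h]
  have hr : ∀ i, i < n → f i ∈ Icc 1 n := by
    intro i hi
    by_cases h : i + 1 ∈ I
    · rw [f1 i h]; exact hV (gV _ h)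
    · rw [f2 i h]; exact (mem_sdiff.1 (kV _ (mem' i hi h))).1
  have hin : ∀ i j, i < n → j < n → f i = f j → i = j := by
    intro i j hi hj e
    by_cases h : i + 1 ∈ I <;> by_cases h' : j + 1 ∈ I
    · rw [f1 i h, f1 j h'] at e
      have := hg.injOn h h' e; omega
    · rw [f1 i h, f2 j h'] at e
      have := (mem_sdiff.1 (kV _ (mem' j hj h'))).2
      rw [← e] at this
      exact absurd (gV _ h) this
    · rw [f2 i h, f1 j h'] at e
      have := (mem_sdiff.1 (kV _ (mem' i hi h))).2
      rw [e] at this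
      exact absurd (gV _ h') this
    · rw [f2 i h, f2 j h'] at e
      have := hk.injOn (mem' i hi h) (mem' j hj h') e; omega
  obtain ⟨σ, hσ⟩ := exists_perm (f := f) (fun i hi => (mem_Icc.1 (hr i hi)).1)
    (fun i hi => (mem_Icc.1 (hr i hi)).2) hin
  have hex : excSet n (pf σ) = (range n).filter fun i => i + 1 ∈ I := by
    ext i
    rw [mem_excSet, mem_filter, mem_range]
    constructor
    · rintro ⟨h1, h2⟩
      refine ⟨h1, ?_⟩
      by_contra h
      rw [hσ i h1, f2 i h] at h2
      have := kex _ (mem' i h1 h)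
      omega
    · rintro ⟨h1, h2⟩
      refine ⟨h1, ?_⟩
      rw [hσ i h1, f1 i h2]
      exact gex _ h2
  have m1 : ∀ i j, i < j → j < n → i + 1 ∈ I → j + 1 ∈ I → pf σ i < pf σ j := by
    intro i j hij hj h1 h2
    rw [hσ i (by omega), hσ j hj, f1 i h1, f1 j h2]
    exact hg h1 h2 (by omega)
  have m2 : ∀ i j, i < j → j < n → i + 1 ∉ I → j + 1 ∉ I → pf σ i < pf σ j := by
    intro i j hij hj h1 h2
    rw [hσ i (by omega), hσ j hj, f2 i h1, f2 j h2]
    exact hk (mem' i (by omega) h1) (mem' j hj h2) (by omega)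
  refine ⟨σ, ?_, ?_⟩
  · rintro ⟨a, b, c, hab, hbc, hcn, h1, h2⟩
    by_cases ha : a + 1 ∈ I <;> by_cases hb : b + 1 ∈ I <;> by_cases hc : c + 1 ∈ I
    · have := m1 a b hab (by omega) ha hb; omega
    · have := m1 a b hab (by omega) ha hb; omega
    · have := m1 a c (by omega) (by omega) ha hc; omega
    · have := m2 b c (by omega) (by omega) hb hc; omega
    · have := m1 b c (by omega) (by omega) hb hc; omega
    · have := m2 a c (by omega) (by omega) ha hc; omega
    · have := m2 a b hab (by omega) ha hb; omega
    · have := m2 a b hab (by omega) ha hb; omega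
  · rw [mapB, hex]
    have hI' : ((range n).filter fun i => i + 1 ∈ I).image (fun p => p + 1) = I := by
      ext x
      simp only [mem_image, mem_filter, mem_range]
      constructor
      · rintro ⟨y, hy, rfl⟩; exact hy.2
      · intro hx
        have := mem_Icc.1 (hI hx)
        have e : x - 1 + 1 = x := by omega
        exact ⟨x - 1, ⟨by omega, by rwa [e]⟩, e⟩
    rw [hI']
    congr 1
    rw [← hgi]
    conv_rhs => rw [← hI', image_image]
    apply image_congr
    intro i hi
    rw [mem_coe, mem_filter, mem_range] at hi
    simp only [Function.comp]
    rw [hσ i hi.1, f1 i hi.2]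

/-! ### Counting -/

open DyckStep in
/-- The Dyck path of a pair of sets. -/
def stp (q : Finset ℕ × Finset ℕ) (j : ℕ) : DyckStep :=
  if j % 2 = 0 then (if j / 2 + 1 ∈ q.2 then D else U) else (if j / 2 + 1 ∈ q.1 then U else D)

theorem filter_le_succ (S : Finset ℕ) (m : ℕ) :
    (S.filter fun v => v ≤ m + 1).card =
      (S.filter fun v => v ≤ m).card + if m + 1 ∈ S then 1 else 0 := by
  split_ifs with h
  · have : (S.filter fun v => v ≤ m + 1) = insert (m + 1) (S.filter fun v => v ≤ m) := by
      ext x; simp only [mem_filter, mem_insert]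
      constructor
      · rintro ⟨a, b⟩
        by_cases hx : x = m + 1
        · exact Or.inl hx
        · exact Or.inr ⟨a, by omega⟩
      · rintro (rfl | ⟨a, b⟩)
        · exact ⟨h, le_rfl⟩
        · exact ⟨a, by omega⟩
    rw [this, card_insert_of_notMem (by simp)]
  · rw [add_zero]
    congr 1
    apply filter_congr
    intro x hx
    have : x ≠ m + 1 := by rintro rfl; exact h hx
    omega

open DyckStep in
theorem stp_even (q : Finset ℕ × Finset ℕ) (h0 : 0 ∉ q.1) (h0' : 0 ∉ q.2) (m : ℕ) :
    ((((List.range (2 * m)).map (stp q)).count U : ℕ) : ℤ) -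
      (((List.range (2 * m)).map (stp q)).count D : ℕ) =
      2 * (((q.1.filter fun v => v ≤ m).card : ℤ) - (q.2.filter fun v => v ≤ m).card) ∧
    ((((List.range (2 * m + 1)).map (stp q)).count U : ℕ) : ℤ) -
      (((List.range (2 * m + 1)).map (stp q)).count D : ℕ) =
      2 * (((q.1.filter fun v => v ≤ m).card : ℤ) - (q.2.filter fun v => v ≤ m + 1).card) + 1 := by
  have odd : ∀ m, ((((List.range (2 * m)).map (stp q)).count U : ℕ) : ℤ) -
      (((List.range (2 * m)).map (stp q)).count D : ℕ) =
      2 * (((q.1.filter fun v => v ≤ m).card : ℤ) - (q.2.filter fun v => v ≤ m).card) →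
    ((((List.range (2 * m + 1)).map (stp q)).count U : ℕ) : ℤ) -
      (((List.range (2 * m + 1)).map (stp q)).count D : ℕ) =
      2 * (((q.1.filter fun v => v ≤ m).card : ℤ) - (q.2.filter fun v => v ≤ m + 1).card) + 1 := by
    intro m h
    rw [List.range_succ, List.map_append, List.count_append, List.count_append, filter_le_succ]
    have : stp q (2 * m) = if m + 1 ∈ q.2 then D else U := by
      simp [stp]
    simp only [List.map_cons, List.map_nil, this]
    split_ifs with h1 <;> simp <;> omega
  induction m with
  | zero =>
    have hz : ∀ S : Finset ℕ, 0 ∉ S → (S.filter fun v => v ≤ 0).card = 0 := by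
      intro S hS
      rw [card_eq_zero, filter_eq_empty_iff]
      intro x hx hx2
      have : x = 0 := by omega
      subst this; exact hS hx
    have h1 : ((((List.range (2 * 0)).map (stp q)).count U : ℕ) : ℤ) -
      (((List.range (2 * 0)).map (stp q)).count D : ℕ) =
      2 * (((q.1.filter fun v => v ≤ 0).card : ℤ) - (q.2.filter fun v => v ≤ 0).card) := by
      rw [hz _ h0, hz _ h0']; simp
    exact ⟨h1, odd 0 h1⟩
  | succ m ih =>
    have h1 : ((((List.range (2 * (m + 1))).map (stp q)).count U : ℕ) : ℤ) -
      (((List.range (2 * (m + 1))).map (stp q)).count D : ℕ) =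
      2 * (((q.1.filter fun v => v ≤ m + 1).card : ℤ) - (q.2.filter fun v => v ≤ m + 1).card) := by
      have h2 := ih.2
      rw [show 2 * (m + 1) = 2 * m + 1 + 1 by ring, List.range_succ, List.map_append,
        List.count_append, List.count_append, filter_le_succ q.1]
      have : stp q (2 * m + 1) = if m + 1 ∈ q.1 then U else D := by
        have e1 : (2 * m + 1) % 2 = 1 := by omega
        have e2 : (2 * m + 1) / 2 = m := by omega
        simp [stp, e1, e2]
      simp only [List.map_cons, List.map_nil, this]
      split_ifs with h1 <;> simp <;> omega
    exact ⟨h1, odd _ h1⟩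

open DyckStep in
theorem exists_dyck {n : ℕ} {q : Finset ℕ × Finset ℕ} (hq : q ∈ PP n) :
    ∃ p : DyckWord, p.semilength = n ∧ p.toList = (List.range (2 * n)).map (stp q) := by
  simp only [PP, mem_filter, mem_product, mem_powerset] at hq
  obtain ⟨⟨hI, hV⟩, hc, hd⟩ := hq
  have h0 : 0 ∉ q.1 := fun h => by simpa using hI h
  have h0' : 0 ∉ q.2 := fun h => by simpa using hV h
  have full : ∀ S : Finset ℕ, S ⊆ Icc 1 n → (S.filter fun v => v ≤ n) = S := by
    intro S hS
    apply filter_true_of_mem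
    intro x hx; exact (mem_Icc.1 (hS hx)).2
  have hUD : ((List.range (2 * n)).map (stp q)).count U =
      ((List.range (2 * n)).map (stp q)).count D := by
    have := (stp_even q h0 h0' n).1
    rw [full _ hI, full _ hV, hc] at this
    omega
  have pre : ∀ i, i ≤ 2 * n → ((List.range i).map (stp q)).count D ≤
      ((List.range i).map (stp q)).count U := by
    intro i hi
    obtain ⟨m, rfl | rfl⟩ := Nat.even_or_odd' i
    · have h1 := (stp_even q h0 h0' m).1
      have h2 := hd m (by omega)
      have h3 : (q.1.filter fun i => i < m).card ≤ (q.1.filter fun i => i ≤ m).card := by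
        apply card_le_card; intro y hy; simp at hy ⊢; exact ⟨hy.1, by omega⟩
      omega
    · have h1 := (stp_even q h0 h0' m).2
      have h2 := hd (m + 1) (by omega)
      have h3 : (q.1.filter fun i => i < m + 1).card = (q.1.filter fun i => i ≤ m).card := by
        congr 1; apply filter_congr; intro y hy; omega
      omega
  refine ⟨⟨(List.range (2 * n)).map (stp q), hUD, ?_⟩, ?_, rfl⟩
  · intro i
    rw [← List.map_take, List.take_range]
    exact pre _ (by omega)
  · have h1 : ∀ l : List DyckStep, l.count U + l.count D = l.length := by
      intro l
      induction l with
      | nil => rfl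
      | cons a l ih => cases a <;> simp <;> omega
    have h2 := h1 ((List.range (2 * n)).map (stp q))
    simp only [List.length_map, List.length_range] at h2
    simp only [DyckWord.semilength]
    omega

theorem card_PP (n : ℕ) : (PP n).card ≤ catalan n := by
  classical
  rw [← DyckWord.card_dyckWord_semilength_eq_catalan, ← Fintype.card_coe]
  choose F hF1 hF2 using fun q : PP n => exists_dyck q.2
  apply Fintype.card_le_of_injective (fun q : PP n => (⟨F q, hF1 q⟩ : { p : DyckWord // p.semilength = n }))
  intro a b hab
  have h1 : F a = F b := by simpa using hab
  have h2 : (List.range (2 * n)).map (stp a) = (List.range (2 * n)).map (stp b) := by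
    rw [← hF2, ← hF2, h1]
  have h3 : ∀ j, j < 2 * n → stp a j = stp b j := by
    intro j hj
    exact List.map_inj_left.1 h2 j (by simpa using hj)
  obtain ⟨⟨I, V⟩, ha⟩ := a
  obtain ⟨⟨I', V'⟩, hb⟩ := b
  simp only [PP, mem_filter, mem_product, mem_powerset] at ha hb
  have e1 : I = I' := by
    ext x
    by_cases hx : x ∈ Icc 1 n
    · rw [mem_Icc] at hx
      have := h3 (2 * (x - 1) + 1) (by omega)
      have e1 : (2 * (x - 1) + 1) % 2 = 1 := by omega
      have e2 : (2 * (x - 1) + 1) / 2 + 1 = x := by omega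
      simp only [stp, e1, e2] at this
      by_cases c1 : x ∈ I <;> by_cases c2 : x ∈ I' <;> simp_all
    · exact ⟨fun h => absurd (ha.1.1 h) hx, fun h => absurd (hb.1.1 h) hx⟩
  have e2 : V = V' := by
    ext x
    by_cases hx : x ∈ Icc 1 n
    · rw [mem_Icc] at hx
      have := h3 (2 * (x - 1)) (by omega)
      have e1 : (2 * (x - 1)) % 2 = 0 := by omega
      have e2 : (2 * (x - 1)) / 2 + 1 = x := by omega
      simp only [stp, e1, e2] at this
      by_cases c1 : x ∈ V <;> by_cases c2 : x ∈ V' <;> simp_all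
    · exact ⟨fun h => absurd (ha.1.2 h) hx, fun h => absurd (hb.1.2 h) hx⟩
  subst e1 e2
  rfl

/-! ### Trees give 231-avoiding words -/

def tw : BinaryTree Unit → ℕ → List ℕ
  | .nil, _ => []
  | .node _ l r, s => (s + l.numNodes) :: (tw l s ++ tw r (s + l.numNodes + 1))

theorem tw_length (t : BinaryTree Unit) : ∀ s, (tw t s).length = t.numNodes := by
  induction t with
  | nil => intro s; simp [tw, BinaryTree.numNodes]
  | node _ l r ihl ihr => intro s; simp [tw, BinaryTree.numNodes, ihl, ihr]

theorem tw_mem (t : BinaryTree Unit) : ∀ s, ∀ x ∈ tw t s, s ≤ x ∧ x < s + t.numNodes := by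
  induction t with
  | nil => intro s; simp [tw]
  | node _ l r ihl ihr =>
    intro s x hx
    simp only [tw, List.mem_cons, List.mem_append] at hx
    simp only [BinaryTree.numNodes]
    rcases hx with rfl | hx | hx
    · omega
    · have := ihl s x hx; omega
    · have := ihr _ x hx; omega

theorem tw_nodup (t : BinaryTree Unit) : ∀ s, (tw t s).Nodup := by
  induction t with
  | nil => intro s; simp [tw]
  | node _ l r ihl ihr =>
    intro s
    simp only [tw, List.nodup_cons, List.mem_append, List.nodup_append]
    refine ⟨?_, ihl _, ihr _, ?_⟩
    · rintro (h | h)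
      · have := tw_mem l _ _ h; omega
      · have := tw_mem r _ _ h; omega
    · intro a ha b hb
      have := tw_mem l _ _ ha
      have := tw_mem r _ _ hb
      omega

theorem tw_inj (t : BinaryTree Unit) : ∀ t' s, tw t s = tw t' s → t = t' := by
  induction t with
  | nil =>
    intro t' s h
    cases t' with
    | nil => rfl
    | node _ l r => simp [tw] at h
  | node _ l r ihl ihr =>
    intro t' s h
    cases t' with
    | nil => simp [tw] at h
    | node _ l' r' =>
      simp only [tw, List.cons.injEq] at h
      have h1 : l.numNodes = l'.numNodes := by omega
      have h2 := List.append_inj h.2 (by rw [tw_length, tw_length, h1])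
      rw [h1] at h2
      rw [ihl _ _ h2.1, ihr _ _ h2.2]

def lav : List ℕ → Prop
  | [] => True
  | x :: l => l.Pairwise (fun b c => ¬ (c < x ∧ x < b)) ∧ lav l

theorem lav_append (A B : List ℕ) (hA : lav A) (hB : lav B) (h : ∀ a ∈ A, ∀ b ∈ B, a < b) :
    lav (A ++ B) := by
  induction A with
  | nil => simpa using hB
  | cons x A ih =>
    simp only [List.cons_append, lav] at hA ⊢
    refine ⟨?_, ih hA.2 (fun a ha => h a (List.mem_cons_of_mem _ ha))⟩
    rw [List.pairwise_append]
    refine ⟨hA.1, ?_, ?_⟩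
    · apply List.pairwise_of_forall_mem_list
      intro a _ b hb
      have := h x (by simp) b hb
      omega
    · intro a _ b hb
      have := h x (by simp) b hb
      omega

theorem tw_lav (t : BinaryTree Unit) : ∀ s, lav (tw t s) := by
  induction t with
  | nil => intro s; simp [tw, lav]
  | node _ l r ihl ihr =>
    intro s
    simp only [tw, lav]
    refine ⟨?_, lav_append _ _ (ihl _) (ihr _) ?_⟩
    · rw [List.pairwise_append]
      refine ⟨?_, ?_, ?_⟩
      · apply List.pairwise_of_forall_mem_list
        intro a ha b _
        have := tw_mem _ _ _ ha
        omega
      · apply List.pairwise_of_forall_mem_list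
        intro a _ b hb
        have := tw_mem _ _ _ hb
        omega
      · intro a ha b _
        have := tw_mem _ _ _ ha
        omega
    · intro a ha b hb
      have := tw_mem _ _ _ ha
      have := tw_mem _ _ _ hb
      omega

theorem lav_av (l : List ℕ) (h : lav l) : Av231 l.length (lf l) := by
  induction l with
  | nil => rintro ⟨i, j, k, _, _, h, _⟩; simp at h
  | cons x l ih =>
    rintro ⟨i, j, k, hij, hjk, hk, h1, h2⟩
    obtain ⟨j, rfl⟩ := Nat.exists_eq_succ_of_ne_zero (show j ≠ 0 by omega)
    obtain ⟨k, rfl⟩ := Nat.exists_eq_succ_of_ne_zero (show k ≠ 0 by omega)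
    simp only [List.length_cons] at hk
    rcases i with _ | i
    · have h3 := List.pairwise_iff_getElem.1 h.1 j k (by omega) (by omega) (by omega)
      apply h3
      have hj' : j < l.length := by omega
      have hk' : k < l.length := by omega
      simpa [lf, hj', hk'] using And.intro h1 h2
    · exact ih h.2 ⟨i, j, k, by omega, by omega, by omega, by simpa [lf] using h1,
        by simpa [lf] using h2⟩

open Classical in
theorem catalan_le (n : ℕ) :
    catalan n ≤ (univ.filter fun σ : Equiv.Perm (Fin n) => Av231 n (pf σ)).card := by
  rw [← BinaryTree.treesOfNumNodesEq_card_eq_catalan]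
  have key : ∀ t ∈ BinaryTree.treesOfNumNodesEq n, ∃ σ : Equiv.Perm (Fin n),
      ∀ i, i < n → pf σ i = lf (tw t 1) i := by
    intro t ht
    rw [BinaryTree.mem_treesOfNumNodesEq] at ht
    have hl := tw_length t 1
    rw [ht] at hl
    have hm : ∀ i, i < n → lf (tw t 1) i ∈ tw t 1 := by
      intro i hi
      have : i < (tw t 1).length := by omega
      simp [lf, this]
    apply exists_perm
    · intro i hi; exact (tw_mem t 1 _ (hm i hi)).1
    · intro i hi
      have := (tw_mem t 1 _ (hm i hi)).2
      omega
    · intro i j hi hj e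
      have hi' : i < (tw t 1).length := by omega
      have hj' : j < (tw t 1).length := by omega
      simp only [lf, List.getD_eq_getElem _ _ hi', List.getD_eq_getElem _ _ hj'] at e
      exact (tw_nodup t 1).getElem_inj_iff.1 e
  choose F hF using key
  apply Finset.card_le_card_of_injOn (fun t => if ht : t ∈ BinaryTree.treesOfNumNodesEq n then F t ht else 1)
  · intro t ht
    have ht' : t ∈ BinaryTree.treesOfNumNodesEq n := ht
    have hl := tw_length t 1
    rw [BinaryTree.mem_treesOfNumNodesEq.1 ht'] at hl
    simp only [ht', dif_pos, coe_filter, mem_univ, true_and, Set.mem_ofPred_eq]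
    have := lav_av _ (tw_lav t 1)
    rw [hl] at this
    rintro ⟨i, j, k, a, b, c, d, e⟩
    rw [hF t ht' _ (by omega), hF t ht' _ (by omega)] at d e
    exact this ⟨i, j, k, a, b, c, d, e⟩
  · intro t ht t' ht' e
    have h1 : t ∈ BinaryTree.treesOfNumNodesEq n := ht
    have h1' : t' ∈ BinaryTree.treesOfNumNodesEq n := ht'
    simp only [h1, h1', dif_pos] at e
    have hl := tw_length t 1
    have hl' := tw_length t' 1
    rw [BinaryTree.mem_treesOfNumNodesEq.1 h1] at hl
    rw [BinaryTree.mem_treesOfNumNodesEq.1 h1'] at hl'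
    apply tw_inj t t' 1
    apply List.ext_getElem (by omega)
    intro i hi hi'
    have a1 := hF t h1 i (by omega)
    have a2 := hF t' h1' i (by omega)
    rw [e, a2] at a1
    simp only [lf, List.getD_eq_getElem _ _ hi, List.getD_eq_getElem _ _ hi'] at a1
    exact a1.symm

open Classical in
theorem mapA_surj {n : ℕ} {q : Finset ℕ × Finset ℕ} (hq : q ∈ PP n) :
    ∃ σ : Equiv.Perm (Fin n), Av231 n (pf σ) ∧ mapA n (pf σ) = q := by
  let S := univ.filter fun σ : Equiv.Perm (Fin n) => Av231 n (pf σ)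
  have hinj : Set.InjOn (fun σ : Equiv.Perm (Fin n) => mapA n (pf σ)) S := by
    intro σ hσ τ hτ e
    simp only [S, coe_filter, mem_univ, true_and, Set.mem_ofPred_eq] at hσ hτ
    exact pf_ext (mapA_inj (pf_isW σ) (pf_isW τ) hσ hτ e)
  have hsub : S.image (fun σ => mapA n (pf σ)) ⊆ PP n := by
    intro x hx
    obtain ⟨σ, _, rfl⟩ := mem_image.1 hx
    exact (mapA_mem (pf_isW σ)).1
  have heq := eq_of_subset_of_card_le hsub (by
    rw [card_image_of_injOn hinj]
    exact (card_PP n).trans (catalan_le n))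
  rw [← heq] at hq
  obtain ⟨σ, h1, h2⟩ := mem_image.1 hq
  exact ⟨σ, (mem_filter.1 h1).2, h2⟩

theorem countA (n k : ℕ) :
    Set.ncard {σ : Equiv.Perm (Fin n) | Av231 n (pf σ) ∧ mad n (pf σ) = k} =
    Set.ncard {q | q ∈ PP n ∧ wt q = k} := by
  apply Set.ncard_congr (fun σ _ => mapA n (pf σ))
  · rintro σ ⟨h1, h2⟩
    have := mapA_mem (pf_isW σ)
    exact ⟨this.1, by rw [this.2, ← mad_eq (pf_isW σ) h1, h2]⟩
  · rintro σ τ ⟨h1, _⟩ ⟨h2, _⟩ e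
    exact pf_ext (mapA_inj (pf_isW σ) (pf_isW τ) h1 h2 e)
  · rintro q ⟨h1, h2⟩
    obtain ⟨σ, h3, rfl⟩ := mapA_surj h1
    refine ⟨σ, ⟨h3, ?_⟩, rfl⟩
    rw [mad_eq (pf_isW σ) h3, ← (mapA_mem (pf_isW σ)).2, h2]

theorem countB (n k : ℕ) :
    Set.ncard {σ : Equiv.Perm (Fin n) | Av321 n (pf σ) ∧ invp n (pf σ) = k} =
    Set.ncard {q | q ∈ PP n ∧ wt q = k} := by
  apply Set.ncard_congr (fun σ _ => mapB n (pf σ))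
  · rintro σ ⟨h1, h2⟩
    have := mapB_mem (pf_isW σ)
    exact ⟨this.1, by rw [this.2, ← inv_eq (pf_isW σ) h1, h2]⟩
  · rintro σ τ ⟨h1, _⟩ ⟨h2, _⟩ e
    exact pf_ext (mapB_inj (pf_isW σ) (pf_isW τ) h1 h2 e)
  · rintro q ⟨h1, h2⟩
    obtain ⟨σ, h3, rfl⟩ := mapB_surj h1
    refine ⟨σ, ⟨h3, ?_⟩, rfl⟩
    rw [inv_eq (pf_isW σ) h3, ← (mapB_mem (pf_isW σ)).2, h2]

/-- `mad` over `S_n(231)` is equidistributed with `inv` over `S_n(321)`. -/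
theorem stmt12 (n : ℕ) (hn : 1 ≤ n) (k : ℕ) :
    Set.ncard {σ : Equiv.Perm (Fin n) | Av231 n (pf σ) ∧ mad n (pf σ) = k} =
    Set.ncard {σ : Equiv.Perm (Fin n) | Av321 n (pf σ) ∧ invp n (pf σ) = k} := by
  rw [countA, countB]

end MahonianStats
end

section
/- There exists a bijection Λ on Dyck paths of semilength n with spea(P) = sups(Λ(P)) for all P; in particular Σ_{P∈Dyck_n} q^{spea(P)} = Σ_{P∈Dyck_n} q^{sups(P)}. -/
namespace MahonianStats

open Finset

/-- Number of up-steps among the first `k` steps. -/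
def ups (P : List Bool) (k : ℕ) : ℕ := (P.take k).count true

/-- Number of down-steps among the first `k` steps. -/
def downs (P : List Bool) (k : ℕ) : ℕ := (P.take k).count false

/-- `P` is a Dyck word (`true` = up-step, `false` = down-step). -/
def IsDyck (P : List Bool) : Prop :=
  P.count true = P.count false ∧ ∀ k, downs P k ≤ ups P k

/-- Dyck paths of semilength `n`. -/
def DyckN (n : ℕ) (P : List Bool) : Prop := IsDyck P ∧ P.length = 2 * n

/-- Height of the path before step `i` (0-indexed). -/
def hB (P : List Bool) (i : ℕ) : ℕ := ups P i - downs P i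

/-- Number of double rises `UU`. -/
def dr (P : List Bool) : ℕ :=
  ((Finset.range P.length).filter fun i =>
    P.getD i false = true ∧ P.getD (i + 1) false = true).card

/-- `sups`: sum over up-steps of `⌈h/2⌉`, `h` the height of the step's lowest point. -/
def sups (P : List Bool) : ℕ :=
  ∑ i ∈ (Finset.range P.length).filter (fun i => P.getD i false = true), (hB P i + 1) / 2

/-- `sdowns`: sum over down-steps of `⌊h/2⌋`, `h` the height of the step's lowest point. -/
def sdowns (P : List Bool) : ℕ :=
  ∑ i ∈ (Finset.range P.length).filter (fun i => P.getD i false = false), hB P (i + 1) / 2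

/-- `spea`: sum over peaks `UD` of (height of apex − 1). -/
def spea (P : List Bool) : ℕ :=
  ∑ i ∈ (Finset.range P.length).filter
      (fun i => i + 1 < P.length ∧ P.getD i false = true ∧ P.getD (i + 1) false = false),
    hB P i

/-- Index of the matching down-step of the up-step at index `i`:
the least `j > i` at which the path returns to the height it had before step `i`. -/
noncomputable def matchD (P : List Bool) (i : ℕ) : ℕ :=
  sInf {j | i < j ∧ ups P (j + 1) + downs P i = ups P i + downs P (j + 1)}

/-- The mass statistic summed over all up-steps: for a double rise `s_i s_{i+1} = UU`,
factor the suffix after `s_i` as `U P₁ D P₂ D` and take `|P₂|/2`; other up-steps get `0`. -/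
noncomputable def Umass (P : List Bool) : ℕ :=
  ∑ i ∈ (Finset.range P.length).filter
      (fun i => P.getD i false = true ∧ P.getD (i + 1) false = true),
    (matchD P i - matchD P (i + 1) - 1) / 2

/-- Start of the tunnel of the valley at step `v`: the greatest `i ≤ v` such that the
height before step `i` equals the height after step `v`. -/
noncomputable def tunnelStart (P : List Bool) (v : ℕ) : ℕ :=
  sSup {i | i ≤ v ∧ ups P i + downs P (v + 1) = ups P (v + 1) + downs P i}

/-- `stun`: sum over valleys `DU` of half the length of the corresponding tunnel. -/
noncomputable def stun (P : List Bool) : ℕ :=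
  ∑ v ∈ (Finset.range P.length).filter
      (fun v => P.getD v false = false ∧ P.getD (v + 1) false = true),
    (v + 1 - tunnelStart P v) / 2

/-- Recursive form of the Dyck condition, starting at height `h`. -/
def DyF : ℕ → List Bool → Prop
  | h, [] => h = 0
  | h, true :: r => DyF (h + 1) r
  | 0, false :: _ => False
  | h + 1, false :: r => DyF h r

/-- Bits of up-steps: is it followed by a down-step? -/
def sBits : List Bool → List Bool
  | [] => []
  | false :: r => sBits r
  | [true] => [false]
  | true :: false :: r => true :: sBits r
  | true :: true :: r => false :: sBits (true :: r)

/-- Bits of down-steps: is it preceded by an up-step? -/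
def tBits : List Bool → List Bool
  | [] => []
  | false :: r => false :: tBits r
  | [true] => []
  | true :: false :: r => true :: tBits r
  | true :: true :: r => tBits (true :: r)

def inter : List Bool → List Bool → List Bool
  | t :: ts, s :: ss => t :: (!s) :: inter ts ss
  | _, _ => []

def EE : ℕ → List Bool → List Bool → Prop
  | x, [], [] => x = 0
  | x, t :: ts, s :: ss => 1 ≤ x + t.toNat ∧ EE (x + t.toNat - s.toNat) ts ss
  | _, _, _ => False

def supR : ℕ → List Bool → ℕ
  | _, [] => 0
  | h, true :: r => (h + 1) / 2 + supR (h + 1) r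
  | h, false :: r => supR (h - 1) r

def speR : ℕ → List Bool → ℕ
  | _, [] => 0
  | h, false :: r => speR (h - 1) r
  | _, [true] => 0
  | h, true :: false :: r => h + speR h r
  | h, true :: true :: r => speR (h + 1) (true :: r)

def wsum : ℕ → List Bool → ℕ
  | _, [] => 0
  | a, s :: ss => a * s.toNat + wsum (a + 1) ss

theorem dyF_iff : ∀ (P : List Bool) (h : ℕ), DyF h P ↔
    (h + P.count true = P.count false ∧ ∀ k, downs P k ≤ h + ups P k)
  | [], h => by simp [DyF, downs, ups]
  | true :: r, h => by
    rw [DyF, dyF_iff r]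
    constructor
    · rintro ⟨h1, h2⟩
      refine ⟨by simp; omega, ?_⟩
      rintro (_ | k)
      · simp [downs, ups]
      · have := h2 k
        simp [downs, ups] at this ⊢; omega
    · rintro ⟨h1, h2⟩
      refine ⟨by simp at h1; omega, fun k => ?_⟩
      have := h2 (k + 1)
      simp [downs, ups] at this ⊢; omega
  | false :: r, 0 => by
    simp only [DyF, false_iff]
    rintro ⟨h1, h2⟩
    have := h2 1
    simp [downs, ups] at this
  | false :: r, h + 1 => by
    rw [DyF, dyF_iff r]
    constructor
    · rintro ⟨h1, h2⟩
      refine ⟨by simp; omega, ?_⟩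
      rintro (_ | k)
      · simp [downs, ups]
      · have := h2 k
        simp [downs, ups] at this ⊢; omega
    · rintro ⟨h1, h2⟩
      refine ⟨by simp at h1; omega, fun k => ?_⟩
      have := h2 (k + 1)
      simp [downs, ups] at this ⊢; omega

theorem sBits_length : ∀ P : List Bool, (sBits P).length = P.count true
  | [] => by simp [sBits]
  | false :: r => by simp [sBits, sBits_length r]
  | [true] => by simp [sBits]
  | true :: false :: r => by simp [sBits, sBits_length r]
  | true :: true :: r => by
    have := sBits_length (true :: r)
    simp [sBits] at this ⊢; omega

theorem tBits_length : ∀ P : List Bool, (tBits P).length = P.count false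
  | [] => by simp [tBits]
  | false :: r => by simp [tBits, tBits_length r]
  | [true] => by simp [tBits]
  | true :: false :: r => by simp [tBits, tBits_length r]
  | true :: true :: r => by
    have := tBits_length (true :: r)
    simp [tBits] at this ⊢; omega

theorem bits_count : ∀ P : List Bool, (tBits P).count true = (sBits P).count true
  | [] => by simp [tBits, sBits]
  | false :: r => by simp [tBits, sBits, bits_count r]
  | [true] => by simp [tBits, sBits]
  | true :: false :: r => by simp [tBits, sBits, bits_count r]
  | true :: true :: r => by
    have := bits_count (true :: r)
    simp [tBits, sBits] at this ⊢; omega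

theorem tBits_head : ∀ (r : List Bool) (h : ℕ), DyF h (true :: r) →
    ∃ u, tBits (true :: r) = true :: u
  | [], h, H => by simp [DyF] at H
  | false :: r, h, H => ⟨_, rfl⟩
  | true :: r, h, H => by
    rw [DyF] at H
    simpa [tBits] using tBits_head r _ H

theorem bits_ineq : ∀ (P : List Bool) (h : ℕ), DyF h P → ∀ i < (sBits P).length,
    ((sBits P).take i).count true + 1 ≤ ((tBits P).take (h + i + 1)).count true
  | [], h, H, i, hi => by simp [sBits] at hi
  | false :: r, 0, H, i, hi => by simp [DyF] at H
  | false :: r, h + 1, H, i, hi => by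
    rw [DyF] at H
    have := bits_ineq r h H i (by simpa [sBits] using hi)
    have e : h + 1 + i + 1 = (h + i + 1) + 1 := by omega
    rw [e]
    simpa [sBits, tBits] using this
  | [true], h, H, i, hi => by simp [DyF] at H
  | true :: false :: r, h, H, i, hi => by
    rw [DyF, DyF] at H
    rcases i with _ | i
    · simp [tBits]
    · have := bits_ineq r h H i (by simpa [sBits] using hi)
      have e : h + (i + 1) + 1 = (h + i + 1) + 1 := by omega
      rw [e]
      simpa [sBits, tBits] using this
  | true :: true :: r, h, H, i, hi => by
    obtain ⟨u, hu⟩ := tBits_head _ _ H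
    rcases i with _ | i
    · rw [hu]; simp
    · rw [DyF] at H
      have := bits_ineq (true :: r) (h + 1) H i (by simpa [sBits] using hi)
      have e : h + (i + 1) + 1 = (h + 1 + i + 1) := by omega
      rw [e]
      simpa [sBits, tBits] using this

theorem EE_of : ∀ (ts ss : List Bool) (x : ℕ), ts.length = ss.length →
    (∀ i < ss.length, (ss.take i).count true + 1 ≤ x + (ts.take (i + 1)).count true) →
    x + ts.count true = ss.count true → EE x ts ss
  | [], [], x, _, _, h => by simpa [EE] using h
  | [], s :: ss, x, h, _, _ => by simp at h
  | t :: ts, [], x, h, _, _ => by simp at h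
  | t :: ts, s :: ss, x, hl, hi, hc => by
    have h0 := hi 0 (by simp)
    have h0' : 1 ≤ x + t.toNat := by cases t <;> simpa using h0
    refine ⟨h0', EE_of ts ss _ (by simpa using hl) ?_ ?_⟩
    · intro i hlt
      have := hi (i + 1) (by simpa using hlt)
      cases t <;> cases s <;> simp at this h0' ⊢ <;> omega
    · cases t <;> cases s <;> simp at hc h0' ⊢ <;> omega

theorem inter_dyF : ∀ (ts ss : List Bool) (x : ℕ), EE x ts ss → DyF (2 * x) (inter ts ss)
  | [], [], x, h => by simpa [EE, inter, DyF] using h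
  | [], s :: ss, x, h => by simp [EE] at h
  | t :: ts, [], x, h => by simp [EE] at h
  | t :: ts, s :: ss, x, ⟨h0, h⟩ => by
    have ih := inter_dyF ts ss _ h
    cases t <;> cases s
    · obtain ⟨y, rfl⟩ : ∃ y, x = y + 1 := ⟨x - 1, by simp at h0; omega⟩
      simpa [inter, DyF, mul_add] using ih
    · obtain ⟨y, rfl⟩ : ∃ y, x = y + 1 := ⟨x - 1, by simp at h0; omega⟩
      simpa [inter, DyF, mul_add] using ih
    · simpa [inter, DyF, mul_add] using ih
    · simpa [inter, DyF, mul_add] using ih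

theorem inter_sup : ∀ (ts ss : List Bool) (x a : ℕ), EE x ts ss →
    2 * supR (2 * x) (inter ts ss) + x * (x + 1) + 2 * (wsum a ts) + 2 * a * x
      = 2 * wsum a ss + 2 * x
  | [], [], x, a, h => by
    simp only [EE] at h; subst h; simp [inter, supR, wsum]
  | [], s :: ss, x, a, h => by simp [EE] at h
  | t :: ts, [], x, a, h => by simp [EE] at h
  | t :: ts, s :: ss, x, a, ⟨h0, h⟩ => by
    have ih := inter_sup ts ss _ (a + 1) h
    cases t <;> cases s
    · obtain ⟨y, rfl⟩ : ∃ y, x = y + 1 := ⟨x - 1, by simp at h0; omega⟩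
      have e1 : 2 * (y + 1) - 1 + 1 = 2 * (y + 1) := by omega
      have e2 : (2 * (y + 1)) / 2 = y + 1 := by omega
      simp [inter, supR, wsum, e1, e2] at ih ⊢
      linarith
    · obtain ⟨y, rfl⟩ : ∃ y, x = y + 1 := ⟨x - 1, by simp at h0; omega⟩
      have e1 : 2 * (y + 1) - 1 - 1 = 2 * y := by omega
      simp [inter, supR, wsum, e1] at ih ⊢
      linarith
    · have e1 : 2 * x + 1 + 1 = 2 * (x + 1) := by omega
      have e2 : (2 * (x + 1)) / 2 = x + 1 := by omega
      have e3 : (2 * x + 1) / 2 = x := by omega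
      simp [inter, supR, wsum, e1, e2, e3] at ih ⊢
      linarith
    · have e3 : (2 * x + 1) / 2 = x := by omega
      simp [inter, supR, wsum, e3] at ih ⊢
      linarith

theorem spe_wsum : ∀ (P : List Bool) (h b : ℕ), DyF h P →
    speR h P + wsum b (tBits P) = wsum (b + h) (sBits P)
  | [], h, b, H => by simp [speR, wsum, tBits, sBits]
  | false :: r, 0, b, H => by simp [DyF] at H
  | false :: r, h + 1, b, H => by
    rw [DyF] at H
    have := spe_wsum r h (b + 1) H
    have e : b + (h + 1) = b + 1 + h := by omega
    simp [speR, wsum, tBits, sBits, e]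
    omega
  | [true], h, b, H => by simp [DyF] at H
  | true :: false :: r, h, b, H => by
    rw [DyF, DyF] at H
    have := spe_wsum r h (b + 1) H
    have e : b + h + 1 = b + 1 + h := by omega
    simp [speR, wsum, tBits, sBits, e]
    omega
  | true :: true :: r, h, b, H => by
    rw [DyF] at H
    have := spe_wsum (true :: r) (h + 1) b H
    simp [speR, wsum, tBits, sBits]
    rw [← add_assoc] at this
    omega

theorem bits_inj : ∀ (P P' : List Bool) (h : ℕ), DyF h P → DyF h P' →
    sBits P = sBits P' → tBits P = tBits P' → P = P'
  | [], [], _, _, _, _, _ => rfl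
  | [], false :: r, _, _, _, _, ht => by simp [tBits] at ht
  | [], true :: r, _, _, H', _, ht => by
    obtain ⟨u, hu⟩ := tBits_head _ _ H'
    rw [hu] at ht; simp [tBits] at ht
  | false :: r, [], _, _, _, _, ht => by simp [tBits] at ht
  | true :: r, [], _, H, _, _, ht => by
    obtain ⟨u, hu⟩ := tBits_head _ _ H
    rw [hu] at ht; simp [tBits] at ht
  | false :: r, true :: r', _, _, H', _, ht => by
    obtain ⟨u, hu⟩ := tBits_head _ _ H'
    rw [hu] at ht; simp [tBits] at ht
  | true :: r, false :: r', _, H, _, _, ht => by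
    obtain ⟨u, hu⟩ := tBits_head _ _ H
    rw [hu] at ht; simp [tBits] at ht
  | false :: r, false :: r', 0, H, _, _, _ => by simp [DyF] at H
  | false :: r, false :: r', h + 1, H, H', hs, ht => by
    rw [DyF] at H H'
    rw [bits_inj r r' h H H' (by simpa [sBits] using hs) (by simpa [tBits] using ht)]
  | [true], true :: r', _, H, _, _, _ => by simp [DyF] at H
  | true :: b :: r, [true], _, _, H', _, _ => by simp [DyF] at H'
  | true :: false :: r, true :: true :: r', _, _, _, hs, _ => by simp [sBits] at hs
  | true :: true :: r, true :: false :: r', _, _, _, hs, _ => by simp [sBits] at hs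
  | true :: false :: r, true :: false :: r', h, H, H', hs, ht => by
    rw [DyF, DyF] at H H'
    rw [bits_inj r r' h H H' (by simpa [sBits] using hs) (by simpa [tBits] using ht)]
  | true :: true :: r, true :: true :: r', h, H, H', hs, ht => by
    rw [DyF] at H H'
    rw [bits_inj (true :: r) (true :: r') (h + 1) H H' (by simpa [sBits] using hs)
      (by simpa [tBits] using ht)]

theorem inter_inj : ∀ (ts ss ts' ss' : List Bool), ts.length = ss.length →
    ts'.length = ss'.length → inter ts ss = inter ts' ss' → ts = ts' ∧ ss = ss'
  | [], [], [], [], _, _, _ => ⟨rfl, rfl⟩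
  | [], [], t :: ts, s :: ss, _, _, h => by simp [inter] at h
  | t :: ts, s :: ss, [], [], _, _, h => by simp [inter] at h
  | t :: ts, s :: ss, t' :: ts', s' :: ss', h1, h2, h => by
    simp only [inter, List.cons.injEq] at h
    obtain ⟨rfl, hb, h⟩ := h
    obtain ⟨rfl, rfl⟩ := inter_inj ts ss ts' ss' (by simpa using h1) (by simpa using h2) h
    exact ⟨rfl, by simpa using hb⟩
  | [], s :: ss, _, _, h, _, _ => by simp at h
  | t :: ts, [], _, _, h, _, _ => by simp at h
  | _, _, [], s :: ss, _, h, _ => by simp at h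
  | _, _, t :: ts, [], _, h, _ => by simp at h

theorem inter_length : ∀ (ts ss : List Bool), ts.length = ss.length →
    (inter ts ss).length = 2 * ss.length
  | [], [], _ => rfl
  | t :: ts, s :: ss, h => by
    have := inter_length ts ss (by simpa using h)
    simp [inter, this]; ring
  | [], s :: ss, h => by simp at h
  | t :: ts, [], h => by simp at h

theorem sup_eq : ∀ (P : List Bool) (h : ℕ), DyF h P →
    (∑ i ∈ Finset.range P.length,
      if P.getD i false = true then (h + ups P i - downs P i + 1) / 2 else 0) = supR h P
  | [], h, _ => by simp [supR]
  | true :: r, h, H => by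
    rw [DyF] at H
    rw [List.length_cons, Finset.sum_range_succ', supR, ← sup_eq r _ H, add_comm]
    congr 1
    refine Finset.sum_congr rfl fun i _ => ?_
    have e : h + (ups r i + 1) = h + 1 + ups r i := by omega
    simp [ups, downs] at e ⊢
    rw [e]
  | false :: r, 0, H => by simp [DyF] at H
  | false :: r, h + 1, H => by
    rw [DyF] at H
    rw [List.length_cons, Finset.sum_range_succ', supR, Nat.add_sub_cancel, ← sup_eq r _ H]
    simp only [List.getD_cons_zero, Bool.false_eq_true, if_false, add_zero]
    refine Finset.sum_congr rfl fun i _ => ?_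
    have e : h + 1 + ups r i - (downs r i + 1) = h + ups r i - downs r i := by omega
    simp [ups, downs] at e ⊢
    rw [e]

/-- The general summand of `spea`. -/
def speT (h : ℕ) (P : List Bool) (i : ℕ) : ℕ :=
  if i + 1 < P.length ∧ P.getD i false = true ∧ P.getD (i + 1) false = false
  then h + ups P i - downs P i else 0

theorem speT_true (h : ℕ) (r : List Bool) (i : ℕ) :
    speT h (true :: r) (i + 1) = speT (h + 1) r i := by
  have e : h + (ups r i + 1) = h + 1 + ups r i := by omega
  simp [speT, ups, downs] at e ⊢
  rw [e]

theorem speT_false (h : ℕ) (r : List Bool) (i : ℕ) :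
    speT (h + 1) (false :: r) (i + 1) = speT h r i := by
  have e : h + 1 + ups r i - (downs r i + 1) = h + ups r i - downs r i := by omega
  simp [speT, ups, downs] at e ⊢
  rw [e]

theorem spe_eq : ∀ (P : List Bool) (h : ℕ), DyF h P →
    (∑ i ∈ Finset.range P.length, speT h P i) = speR h P
  | [], h, _ => by simp [speR]
  | false :: r, 0, H => by simp [DyF] at H
  | false :: r, h + 1, H => by
    rw [DyF] at H
    rw [List.length_cons, Finset.sum_range_succ', speR, Nat.add_sub_cancel, ← spe_eq r _ H]
    simp only [speT_false]
    simp [speT]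
  | [true], h, H => by simp [DyF] at H
  | true :: false :: r, h, H => by
    rw [DyF, DyF] at H
    rw [List.length_cons, List.length_cons, Finset.sum_range_succ', Finset.sum_range_succ', speR,
      ← spe_eq r _ H]
    simp only [speT_false, speT_true]
    simp [speT, ups, downs]
    omega
  | true :: true :: r, h, H => by
    rw [DyF] at H
    rw [List.length_cons, Finset.sum_range_succ', speR, ← spe_eq (true :: r) _ H]
    simp only [speT_true]
    simp [speT, ups, downs]

theorem dyckN_iff (n : ℕ) (P : List Bool) : DyckN n P ↔ DyF 0 P ∧ P.length = 2 * n := by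
  rw [dyF_iff]; simp [DyckN, IsDyck]

theorem spea_eq (P : List Bool) (H : DyF 0 P) : spea P = speR 0 P := by
  rw [← spe_eq P 0 H, spea, Finset.sum_filter]
  simp [speT, hB]

theorem sups_eq (P : List Bool) (H : DyF 0 P) : sups P = supR 0 P := by
  rw [← sup_eq P 0 H, sups, Finset.sum_filter]
  simp [hB]

def Lam (P : List Bool) : List Bool := inter (tBits P) (sBits P)

theorem bits_len (P : List Bool) (H : DyF 0 P) : (tBits P).length = (sBits P).length := by
  rw [tBits_length, sBits_length]
  have := ((dyF_iff _ _).1 H).1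
  omega

theorem bits_EE (P : List Bool) (H : DyF 0 P) : EE 0 (tBits P) (sBits P) := by
  refine EE_of _ _ _ (bits_len P H) ?_ (by simpa using bits_count P)
  intro i hi
  simpa using bits_ineq P 0 H i hi

theorem Lam_dyck (n : ℕ) (P : List Bool) (H : DyckN n P) : DyckN n (Lam P) := by
  rw [dyckN_iff] at H ⊢
  refine ⟨by simpa [Lam] using inter_dyF _ _ _ (bits_EE P H.1), ?_⟩
  rw [Lam, inter_length _ _ (bits_len P H.1), ← H.2, sBits_length]
  have h1 := ((dyF_iff _ _).1 H.1).1
  have h2 := List.count_true_add_count_false P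
  omega

theorem Lam_stat (P : List Bool) (H : DyF 0 P) (H' : DyF 0 (Lam P)) :
    spea P = sups (Lam P) := by
  rw [spea_eq P H, sups_eq _ H']
  have h1 := spe_wsum P 0 0 H
  have h2 := inter_sup _ _ 0 0 (bits_EE P H)
  simp only [Lam]
  simp at h1 h2
  omega

/-- there is a bijection `Λ` on Dyck paths of semilength `n` with
`spea(P) = sups(Λ P)`; in particular `spea` and `sups` are equidistributed over
`Dyck_n`. -/
theorem stmt13 (n : ℕ) :
    (∃ Λ : {P : List Bool // DyckN n P} ≃ {P : List Bool // DyckN n P},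
        ∀ P : {P : List Bool // DyckN n P}, spea P.1 = sups (Λ P).1) ∧
    (∀ k : ℕ,
      Set.ncard {P : List Bool | DyckN n P ∧ spea P = k} =
      Set.ncard {P : List Bool | DyckN n P ∧ sups P = k}) := by
  have key : ∃ Λ : {P : List Bool // DyckN n P} ≃ {P : List Bool // DyckN n P},
      ∀ P : {P : List Bool // DyckN n P}, spea P.1 = sups (Λ P).1 := by
    have fin : Finite {P : List Bool // DyckN n P} :=
      Set.Finite.subset (List.finite_length_eq Bool (2 * n)) (fun P (hP : DyckN n P) => hP.2)
    let f : {P : List Bool // DyckN n P} → {P : List Bool // DyckN n P} :=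
      fun P => ⟨Lam P.1, Lam_dyck n P.1 P.2⟩
    have hf : Function.Injective f := by
      rintro ⟨P, hP⟩ ⟨P', hP'⟩ h
      have h' : Lam P = Lam P' := congrArg Subtype.val h
      have d := ((dyckN_iff n P).1 hP).1
      have d' := ((dyckN_iff n P').1 hP').1
      obtain ⟨a, b⟩ := inter_inj _ _ _ _ (bits_len P d) (bits_len P' d') h'
      exact Subtype.ext (bits_inj P P' 0 d d' b a)
    refine ⟨Equiv.ofBijective f (Finite.injective_iff_bijective.1 hf), fun P => ?_⟩
    exact Lam_stat P.1 ((dyckN_iff n _).1 P.2).1 ((dyckN_iff n _).1 (f P).2).1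
  refine ⟨key, fun k => ?_⟩
  obtain ⟨Λ, hΛ⟩ := key
  refine Set.ncard_congr (fun P hP => (Λ ⟨P, hP.1⟩).1) ?_ ?_ ?_
  · rintro P ⟨hP, rfl⟩
    exact ⟨(Λ ⟨P, hP⟩).2, (hΛ ⟨P, hP⟩).symm⟩
  · intro P P' hP hP' h
    exact congrArg Subtype.val (Λ.injective (Subtype.ext h))
  · rintro Q ⟨hQ, rfl⟩
    refine ⟨(Λ.symm ⟨Q, hQ⟩).1, ⟨(Λ.symm ⟨Q, hQ⟩).2, ?_⟩, ?_⟩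
    · rw [hΛ]; simp
    · simp


end MahonianStats
end

section
/- For any n ≥ 1, Σ_{σ ∈ S_n(231)} q^{mad(σ)} = Σ_{σ ∈ S_n(132)} q^{SIST12(σ)}, where SIST12 = 2·(13-2) + (2-13) + des. -/
namespace MahonianStats

open Finset

/-- The Mahonian statistic `2·(13-2) + (2-13) + des`. -/
def sist12 (n : ℕ) (f : ℕ → ℕ) : ℕ := 2 * p13_2 n f + p2_13 n f + des n f

/-- binary trees -/
inductive BT where
  | nil : BT
  | node : BT → BT → BT

namespace BT

def size : BT → ℕ
  | nil => 0
  | node L R => size L + size R + 1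

def rsz : BT → ℕ
  | nil => 0
  | node _ R => size R

def ne : BT → ℕ
  | nil => 0
  | node _ _ => 1

def dl : BT → ℕ
  | nil => 0
  | node L R => dl L + dl R + ne L

def ar : BT → ℕ
  | nil => 0
  | node L R => ar L + ar R + ne R

def oc : BT → ℕ
  | nil => 0
  | node L R => oc L + oc R + rsz L

def psi : BT → BT → BT × BT
  | nil, nil => (nil, nil)
  | nil, node A B => (node (psi A B).1 nil, (psi A B).2)
  | node L nil, R => (nil, node (psi L R).1 (psi L R).2)
  | node L (node C D), R =>
      (node (psi L R).1 (node (psi C D).1 (psi C D).2), (psi L R).2)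
termination_by L R => size L + size R
decreasing_by all_goals simp only [size]; omega

theorem psi_invol (L R : BT) : psi (psi L R).1 (psi L R).2 = (L, R) := by
  induction L, R using psi.induct with
  | case1 => simp [psi]
  | case2 A B ih => simp [psi, ih]
  | case3 R L ih => simp [psi, ih]
  | case4 R L C D ih1 ih2 => simp [psi, ih1, ih2]

theorem psi_stat (L R : BT) :
    size (node (psi L R).1 (psi L R).2) = size (node L R) ∧
    dl (node (psi L R).1 (psi L R).2) = ar (node L R) ∧
    ar (node (psi L R).1 (psi L R).2) = dl (node L R) ∧
    oc (node (psi L R).1 (psi L R).2) = oc (node L R) := by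
  induction L, R using psi.induct with
  | case1 => simp [psi, dl, ar]
  | case2 A B ih => simp only [psi, size, dl, ar, oc, ne, rsz] at *; omega
  | case3 R L ih => simp only [psi, size, dl, ar, oc, ne, rsz] at *; omega
  | case4 R L C D ih1 ih2 => simp only [psi, size, dl, ar, oc, ne, rsz] at *; omega

def phi : BT → BT
  | nil => nil
  | node L R => node (psi L R).1 (psi L R).2

theorem phi_invol (T : BT) : phi (phi T) = T := by
  cases T with
  | nil => rfl
  | node L R => simp [phi, psi_invol]

theorem phi_stat (T : BT) : size (phi T) = size T ∧ dl (phi T) = ar T ∧ ar (phi T) = dl T ∧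
    oc (phi T) = oc T := by
  cases T with
  | nil => simp [phi, dl, ar]
  | node L R => exact psi_stat L R

/-- word of a tree -/
def w : BT → ℕ → List ℕ
  | nil, _ => []
  | node L R, o => (o + size L) :: (w L o ++ w R (o + size L + 1))

theorem w_length (T : BT) : ∀ o, (w T o).length = size T := by
  induction T with
  | nil => intro o; rfl
  | node L R ihL ihR => intro o; simp [w, size, ihL, ihR]

theorem mem_w (T : BT) : ∀ o x, x ∈ w T o ↔ o ≤ x ∧ x < o + size T := by
  induction T with
  | nil => intro o x; simp [w, size]
  | node L R ihL ihR => intro o x; simp only [w, size, List.mem_cons, List.mem_append, ihL, ihR]; omega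

theorem nodup_w (T : BT) : ∀ o, (w T o).Nodup := by
  induction T with
  | nil => intro o; simp [w]
  | node L R ihL ihR =>
    intro o
    simp only [w, List.nodup_cons, List.nodup_append, List.mem_append, mem_w, ihL, ihR]
    refine ⟨by omega, trivial, trivial, ?_⟩
    intro a ha b hb; omega

theorem w_inj (T : BT) : ∀ T' o, w T o = w T' o → T = T' := by
  induction T with
  | nil => intro T' o h; cases T' with
    | nil => rfl
    | node => simp [w] at h
  | node L R ihL ihR =>
    intro T' o h
    cases T' with
    | nil => simp [w] at h
    | node L' R' =>
      simp only [w, List.cons.injEq] at h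
      obtain ⟨h1, h2⟩ := h
      have h3 : size L = size L' := by omega
      obtain ⟨h4, h5⟩ := List.append_inj h2 (by simp [w_length, h3])
      rw [h3] at h5
      rw [ihL _ _ h4, ihR _ _ h5]

end BT

def AvL : List ℕ → Prop
  | [] => True
  | a :: l => l.Pairwise (fun b c => ¬ (c < a ∧ a < b)) ∧ AvL l

def desL : List ℕ → ℕ
  | [] => 0
  | [_] => 0
  | a :: b :: l => (if b < a then 1 else 0) + desL (b :: l)

def ascL : List ℕ → ℕ
  | [] => 0
  | [_] => 0
  | a :: b :: l => (if a < b then 1 else 0) + ascL (b :: l)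

def occL : List ℕ → ℕ
  | [] => 0
  | [_] => 0
  | a :: b :: l => l.countP (fun x => b < x ∧ x < a) + occL (b :: l)

theorem AvL_sublist {l l' : List ℕ} (h : l.Sublist l') (hl : AvL l') : AvL l := by
  induction h with
  | slnil => trivial
  | cons a h ih => exact ih hl.2
  | cons_cons a h ih => exact ⟨hl.1.sublist h, ih hl.2⟩

theorem AvL_append (S B : List ℕ) (h : ∀ x ∈ S, ∀ y ∈ B, x < y) (hS : AvL S) (hB : AvL B) :
    AvL (S ++ B) := by
  induction S with
  | nil => exact hB
  | cons a S ih =>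
    refine ⟨?_, ih (fun x hx => h x (by simp [hx])) hS.2⟩
    change (S ++ B).Pairwise _
    rw [List.pairwise_append]
    refine ⟨hS.1, ?_, ?_⟩
    · rw [List.pairwise_iff_forall_sublist]
      intro b c hbc
      have := h a (by simp) c (hbc.subset (by simp))
      omega
    · intro x hx c hc
      have := h a (by simp) c hc
      omega

theorem AvL_w (T : BT) : ∀ o, AvL (T.w o) := by
  induction T with
  | nil => intro o; trivial
  | node L R ihL ihR =>
    intro o
    refine ⟨?_, AvL_append _ _ ?_ (ihL _) (ihR _)⟩
    · rw [List.pairwise_append]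
      refine ⟨?_, ?_, ?_⟩
      · rw [List.pairwise_iff_forall_sublist]
        intro b c hbc
        have : b ∈ L.w o := hbc.subset (by simp)
        rw [BT.mem_w] at this
        omega
      · rw [List.pairwise_iff_forall_sublist]
        intro b c hbc
        have : c ∈ R.w _ := hbc.subset (by simp)
        rw [BT.mem_w] at this
        omega
      · intro b hb c hc
        rw [BT.mem_w] at *
        omega
    · intro b hb c hc
      rw [BT.mem_w] at *
      omega

theorem split_filter (a : ℕ) (l : List ℕ) (ha : a ∉ l)
    (h : l.Pairwise (fun b c => ¬ (c < a ∧ a < b))) :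
    l = l.filter (fun x => x < a) ++ l.filter (fun x => a < x) := by
  induction l with
  | nil => rfl
  | cons b l ih =>
    rw [List.pairwise_cons] at h
    simp only [List.mem_cons, not_or] at ha
    have ih := ih ha.2 h.2
    rcases lt_or_gt_of_ne ha.1 with hb | hb
    · have h1 : l.filter (fun x => x < a) = [] := by
        rw [List.filter_eq_nil_iff]
        intro x hx
        have := h.1 x hx
        simp only [decide_eq_true_eq]; omega
      rw [h1] at ih
      simp only [List.nil_append] at ih
      rw [List.filter_cons_of_neg (by simp; omega), List.filter_cons_of_pos (by simpa using hb), h1,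
        List.nil_append, ← ih]
    · rw [List.filter_cons_of_pos (by simpa using hb), List.filter_cons_of_neg (by simp; omega),
        List.cons_append, ← ih]

theorem exists_tree (m : ℕ) : ∀ (l : List ℕ) (o n : ℕ), l.length ≤ m → l.Nodup →
    (∀ x, x ∈ l ↔ o ≤ x ∧ x < o + n) → AvL l → ∃ T : BT, T.w o = l := by
  induction m with
  | zero =>
    intro l o n hl _ _ _
    have : l = [] := List.length_eq_zero_iff.mp (by omega)
    exact ⟨BT.nil, by rw [this]; rfl⟩
  | succ m ih =>
    intro l o n hl hnd hm hav
    cases l with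
    | nil => exact ⟨BT.nil, rfl⟩
    | cons a l =>
      rw [List.nodup_cons] at hnd
      have hsp := split_filter a l hnd.1 hav.1
      have hln : l.length ≤ m := by simpa using hl
      have ha := (hm a).1 (by simp)
      obtain ⟨L, hL⟩ := ih (l.filter (fun x => x < a)) o (a - o)
        ((List.length_filter_le _ _).trans hln) (hnd.2.filter _) (by
          intro x
          have := hm x
          simp only [List.mem_cons] at this
          simp only [List.mem_filter, decide_eq_true_eq]
          constructor
          · rintro ⟨h1, h2⟩
            have := this.1 (Or.inr h1)
            omega
          · rintro ⟨h1, h2⟩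
            have := this.2 (by omega)
            exact ⟨this.resolve_left (by omega), by omega⟩)
        (AvL_sublist List.filter_sublist hav.2)
      obtain ⟨R, hR⟩ := ih (l.filter (fun x => a < x)) (a + 1) (o + n - (a + 1))
        ((List.length_filter_le _ _).trans hln) (hnd.2.filter _) (by
          intro x
          have := hm x
          simp only [List.mem_cons] at this
          simp only [List.mem_filter, decide_eq_true_eq]
          constructor
          · rintro ⟨h1, h2⟩
            have := this.1 (Or.inr h1)
            omega
          · rintro ⟨h1, h2⟩
            have := this.2 (by omega)
            exact ⟨this.resolve_left (by omega), by omega⟩)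
        (AvL_sublist List.filter_sublist hav.2)
      have hs : o + L.size = a := by
        have h1 := fun x => BT.mem_w L o x
        simp only [hL, List.mem_filter, decide_eq_true_eq] at h1
        have h2 := h1 a
        simp only [lt_irrefl, and_false, false_iff] at h2
        by_contra hne
        have h3 : o + L.size < a := by omega
        have h4 := (hm (o + L.size)).2 (by omega)
        have h5 := (h1 (o + L.size)).1 ⟨by
          rcases List.mem_cons.1 h4 with h | h
          · omega
          · exact h, h3⟩
        omega
      refine ⟨BT.node L R, ?_⟩
      simp only [BT.w, hs, hL, hR]
      rw [← hsp]

theorem occL_append (S B : List ℕ) (h : ∀ x ∈ S, ∀ y ∈ B, x < y) :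
    occL (S ++ B) = occL S + occL B := by
  induction S with
  | nil => simp [occL]
  | cons a S ih =>
    have ih := ih (fun x hx => h x (by simp [hx]))
    have hc : ∀ (b : ℕ) (B' : List ℕ), (∀ y ∈ B', a < y) →
        B'.countP (fun x => b < x ∧ x < a) = 0 := by
      intro b B' hB
      rw [List.countP_eq_zero]
      intro x hx
      have := hB x hx
      simp only [decide_eq_true_eq]; omega
    cases S with
    | nil =>
      cases B with
      | nil => simp [occL]
      | cons b B =>
        have := hc b B (fun y hy => h a (by simp) y (by simp [hy]))
        simp only [List.cons_append, List.nil_append, occL, this]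
    | cons s S =>
      have := hc s B (fun y hy => h a (by simp) y hy)
      simp only [List.cons_append, occL, List.countP_append, this] at *
      omega

theorem occL_w (T : BT) : ∀ o, occL (T.w o) = T.oc := by
  induction T with
  | nil => intro o; rfl
  | node L R ihL ihR =>
    intro o
    have hlt : ∀ x ∈ L.w o, ∀ y ∈ R.w (o + L.size + 1), x < y := by
      intro x hx y hy
      rw [BT.mem_w] at hx hy
      omega
    have happ := occL_append _ _ hlt
    rw [ihL, ihR] at happ
    cases L with
    | nil =>
      have h2 := occL_append [o + BT.nil.size] (R.w (o + BT.nil.size + 1)) (by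
        intro x hx y hy
        rw [BT.mem_w] at hy
        simp only [List.mem_singleton] at hx
        omega)
      simp only [BT.w, List.nil_append, List.cons_append, ihR] at *
      rw [h2]; simp [occL, BT.oc, BT.rsz]
    | node L1 R1 =>
      simp only [BT.w, List.cons_append] at happ ⊢
      rw [occL, happ]
      simp only [List.countP_append, BT.oc, BT.rsz]
      have e1 : (L1.w o).countP (fun x => o + L1.size < x ∧ x < o + (L1.node R1).size) = 0 := by
        rw [List.countP_eq_zero]
        intro x hx
        rw [BT.mem_w] at hx
        simp only [decide_eq_true_eq]; omega
      have e2 : (R1.w (o + L1.size + 1)).countP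
          (fun x => o + L1.size < x ∧ x < o + (L1.node R1).size) = R1.size := by
        refine (List.countP_eq_length.2 ?_).trans (BT.w_length R1 (o + L1.size + 1))
        intro x hx
        rw [BT.mem_w] at hx
        have hs : (L1.node R1).size = L1.size + R1.size + 1 := rfl
        apply decide_eq_true
        omega
      have e3 : (R.w (o + (L1.node R1).size + 1)).countP
          (fun x => o + L1.size < x ∧ x < o + (L1.node R1).size) = 0 := by
        rw [List.countP_eq_zero]
        intro x hx
        rw [BT.mem_w] at hx
        simp only [decide_eq_true_eq]; omega
      rw [e1, e2, e3]
      omega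

def neL : List ℕ → ℕ
  | [] => 0
  | _ :: _ => 1

theorem neL_w (T : BT) (o : ℕ) : neL (T.w o) = T.ne := by cases T <;> rfl

theorem desL_append (S B : List ℕ) (h : ∀ x ∈ S, ∀ y ∈ B, x < y) :
    desL (S ++ B) = desL S + desL B := by
  induction S with
  | nil => simp [desL]
  | cons a S ih =>
    have ih := ih (fun x hx => h x (by simp [hx]))
    cases S with
    | nil =>
      cases B with
      | nil => simp [desL]
      | cons b B =>
        have := h a (by simp) b (by simp)
        simp only [List.cons_append, List.nil_append, desL, if_neg (not_lt.2 this.le)]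
    | cons s S =>
      simp only [List.cons_append, desL] at *
      omega

theorem ascL_append (a : ℕ) (S B : List ℕ) (h : ∀ x ∈ a :: S, ∀ y ∈ B, x < y) :
    ascL (a :: S ++ B) = ascL (a :: S) + ascL B + neL B := by
  induction S generalizing a with
  | nil =>
    cases B with
    | nil => simp [ascL, neL]
    | cons b B =>
      have := h a (by simp) b (by simp)
      simp only [List.cons_append, List.nil_append, ascL, if_pos this, neL]
      omega
  | cons s S ih =>
    have ih := ih s (fun x hx => h x (List.mem_cons_of_mem _ hx))
    simp only [List.cons_append, ascL] at *
    omega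

theorem desL_cons (a : ℕ) (S : List ℕ) (h : ∀ x ∈ S, x < a) :
    desL (a :: S) = desL S + neL S := by
  cases S with
  | nil => rfl
  | cons s S => simp only [desL, neL, if_pos (h s (by simp))]; omega

theorem ascL_cons (a : ℕ) (S : List ℕ) (h : ∀ x ∈ S, x < a) :
    ascL (a :: S) = ascL S := by
  cases S with
  | nil => rfl
  | cons s S => simp only [ascL, if_neg (not_lt.2 (h s (by simp)).le)]; omega

theorem desasc_w (T : BT) : ∀ o, desL (T.w o) = T.dl ∧ ascL (T.w o) = T.ar := by
  induction T with
  | nil => intro o; exact ⟨rfl, rfl⟩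
  | node L R ihL ihR =>
    intro o
    have h1 : ∀ x ∈ L.w o, x < o + L.size := by
      intro x hx
      rw [BT.mem_w] at hx
      omega
    have hlt : ∀ x ∈ (o + L.size) :: L.w o, ∀ y ∈ R.w (o + L.size + 1), x < y := by
      intro x hx y hy
      rw [List.mem_cons, BT.mem_w] at hx
      rw [BT.mem_w] at hy
      omega
    have a1 := desL_append _ _ hlt
    have a2 := ascL_append _ _ _ hlt
    rw [desL_cons _ _ h1] at a1
    rw [ascL_cons _ _ h1] at a2
    simp only [neL_w, (ihL _).1, (ihL _).2, (ihR _).1, (ihR _).2] at a1 a2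
    simp only [BT.w, BT.dl, BT.ar]
    rw [← List.cons_append, a1, a2]
    omega

/-! bridging index statistics and list statistics -/

def ascn (n : ℕ) (f : ℕ → ℕ) : ℕ := ((range (n - 1)).filter fun i => f i < f (i + 1)).card

theorem lf_zero (a : ℕ) (l : List ℕ) : lf (a :: l) 0 = a := rfl
theorem lf_succ (a : ℕ) (l : List ℕ) (i : ℕ) : lf (a :: l) (i + 1) = lf l i := rfl

theorem des_lf (l : List ℕ) : des l.length (lf l) = desL l := by
  induction l with
  | nil => rfl
  | cons a l ih =>
    cases l with
    | nil => rfl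
    | cons b l =>
      simp only [des, desSet, card_filter, List.length_cons, Nat.add_sub_cancel, desL] at *
      rw [sum_range_succ', ← ih, add_comm]
      rfl

theorem asc_lf (l : List ℕ) : ascn l.length (lf l) = ascL l := by
  induction l with
  | nil => rfl
  | cons a l ih =>
    cases l with
    | nil => rfl
    | cons b l =>
      simp only [ascn, card_filter, List.length_cons, Nat.add_sub_cancel, ascL] at *
      rw [sum_range_succ', ← ih, add_comm]
      rfl

theorem countP_lf (l : List ℕ) (p : ℕ → Prop) [DecidablePred p] :
    ∑ i ∈ range l.length, (if p (lf l i) then 1 else 0) = l.countP (fun x => p x) := by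
  induction l with
  | nil => rfl
  | cons a l ih =>
    rw [List.length_cons, sum_range_succ', List.countP_cons]
    simp only [lf_succ, lf_zero, decide_eq_true_eq]
    rw [← ih]
    rfl

theorem occ_lf (l : List ℕ) : p31_2 l.length (lf l) = occL l := by
  induction l with
  | nil => rfl
  | cons a l ih =>
    cases l with
    | nil => simp [p31_2, occL]
    | cons b l =>
      have hc := countP_lf l (fun x => b < x ∧ x < a)
      rw [occL, ← hc, ← ih]
      simp only [p31_2, card_filter, sum_product, List.length_cons]
      rw [sum_range_succ', add_comm]
      congr 1
      · rw [sum_range_succ', sum_range_succ']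
        simp [lf_succ, lf_zero]
      · refine sum_congr rfl fun i _ => ?_
        rw [sum_range_succ']
        simp only [lf_succ, Nat.add_lt_add_iff_right, Nat.not_lt_zero, false_and, if_false,
          add_zero]
        refine sum_congr rfl fun j _ => ?_
        congr 1

theorem av_lf (l : List ℕ) : Av231 l.length (lf l) ↔ AvL l := by
  induction l with
  | nil => simp [Av231, AvL]
  | cons a l ih =>
    rw [AvL, ← ih, List.pairwise_iff_getElem]
    have hg : ∀ i (h : i < l.length), l[i] = lf l i := by
      intro i h; simp [lf, h]
    constructor
    · intro h
      constructor
      · intro i j hi hj hij hh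
        rw [hg, hg] at hh
        exact h ⟨0, i + 1, j + 1, by omega, by omega, by simpa using hj, by
          simpa only [lf_succ, lf_zero] using hh⟩
      · rintro ⟨i, j, k, h1, h2, h3, h4⟩
        exact h ⟨i + 1, j + 1, k + 1, by omega, by omega, by simpa using h3, by
          simpa only [lf_succ, lf_zero] using h4⟩
    · rintro ⟨h1, h2⟩ ⟨i, j, k, hij, hjk, hk, hh⟩
      obtain ⟨j, rfl⟩ : ∃ j', j = j' + 1 := ⟨j - 1, by omega⟩
      obtain ⟨k, rfl⟩ : ∃ k', k = k' + 1 := ⟨k - 1, by omega⟩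
      have hk' : k < l.length := by simpa using hk
      cases i with
      | zero =>
        have := h1 j k (by omega) hk' (by omega)
        rw [hg, hg] at this
        exact this hh
      | succ i => exact h2 ⟨i, j, k, by omega, by omega, hk', hh⟩

def word {n : ℕ} (σ : Equiv.Perm (Fin n)) : List ℕ := List.ofFn fun i => ((σ i : Fin n) : ℕ) + 1

theorem word_length {n : ℕ} (σ : Equiv.Perm (Fin n)) : (word σ).length = n := by simp [word]

theorem lf_word {n : ℕ} (σ : Equiv.Perm (Fin n)) : lf (word σ) = pf σ := by
  funext i
  by_cases h : i < n
  · simp [lf, pf, word, h]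
  · simp [lf, pf, word, h]

theorem word_inj {n : ℕ} : Function.Injective (word (n := n)) := by
  intro σ τ h
  have := List.ofFn_injective h
  ext i
  have := congrFun this i
  simpa using this

theorem word_surj {n : ℕ} (l : List ℕ) (hl : l.length = n) (hnd : l.Nodup)
    (hm : ∀ x, x ∈ l ↔ 1 ≤ x ∧ x < 1 + n) : ∃ σ : Equiv.Perm (Fin n), word σ = l := by
  subst hl
  have hb : ∀ i : Fin l.length, l[i] - 1 < l.length := by
    intro i
    have := (hm l[i]).1 (List.getElem_mem _)
    omega
  let f : Fin l.length → Fin l.length := fun i => ⟨l[i] - 1, hb i⟩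
  have hf : Function.Injective f := by
    intro i j hij
    have h1 := (hm l[i]).1 (List.getElem_mem _)
    have h2 := (hm l[j]).1 (List.getElem_mem _)
    have h3 : l[i] - 1 = l[j] - 1 := congrArg Fin.val hij
    have h4 : l[i] = l[j] := by omega
    exact Fin.ext ((List.Nodup.getElem_inj_iff hnd).1 h4)
  refine ⟨Equiv.ofBijective f (Finite.injective_iff_bijective.1 hf), ?_⟩
  apply List.ext_getElem
  · simp [word]
  · intro i h1 h2
    have := (hm l[i]).1 (List.getElem_mem _)
    simp only [word, List.getElem_ofFn, Equiv.ofBijective_apply, f]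
    simp only [Fin.getElem_fin]
    omega

theorem word_mem {n : ℕ} (σ : Equiv.Perm (Fin n)) (x : ℕ) :
    x ∈ word σ ↔ 1 ≤ x ∧ x < 1 + n := by
  simp only [word, List.mem_ofFn]
  constructor
  · rintro ⟨i, rfl⟩
    have := (σ i).2
    omega
  · rintro ⟨h1, h2⟩
    exact ⟨σ.symm ⟨x - 1, by omega⟩, by simp; omega⟩

theorem word_nodup {n : ℕ} (σ : Equiv.Perm (Fin n)) : (word σ).Nodup := by
  rw [word, List.nodup_ofFn]
  intro i j h
  apply σ.injective
  apply Fin.ext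
  simpa using h

theorem count_trees (n : ℕ) (st : ℕ → (ℕ → ℕ) → ℕ) (sT : BT → ℕ)
    (h : ∀ T : BT, st T.size (lf (T.w 1)) = sT T) (k : ℕ) :
    Set.ncard {σ : Equiv.Perm (Fin n) | Av231 n (pf σ) ∧ st n (pf σ) = k} =
    Set.ncard {T : BT | T.size = n ∧ sT T = k} := by
  have hinj : Function.Injective (fun T : BT => T.w 1) := fun T T' h => BT.w_inj T T' 1 h
  rw [← Set.ncard_image_of_injective _ (word_inj (n := n)), ← Set.ncard_image_of_injective _ hinj]
  congr 1
  ext l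
  simp only [Set.mem_image, Set.mem_ofPred_eq]
  constructor
  · rintro ⟨σ, ⟨h1, h2⟩, rfl⟩
    have hav : AvL (word σ) := by
      rw [← av_lf, word_length, lf_word]; exact h1
    obtain ⟨T, hT⟩ := exists_tree _ (word σ) 1 n le_rfl (word_nodup σ) (word_mem σ) hav
    have hsz : T.size = n := by rw [← BT.w_length T 1, hT, word_length]
    refine ⟨T, ⟨hsz, ?_⟩, hT⟩
    rw [← h, hT, hsz, lf_word, h2]
  · rintro ⟨T, ⟨h1, h2⟩, rfl⟩
    obtain ⟨σ, hσ⟩ := word_surj (n := n) (T.w 1) (by rw [BT.w_length, h1]) (BT.nodup_w T 1)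
      (by intro x; rw [BT.mem_w, h1])
    refine ⟨σ, ⟨?_, ?_⟩, hσ⟩
    · have := AvL_w T 1
      rwa [← av_lf, BT.w_length, h1, ← hσ, lf_word] at this
    · rw [← h2, ← h, ← hσ, lf_word, h1]

theorem mad_eq_s16 (n : ℕ) (f : ℕ → ℕ) (h : Av231 n f) : mad n f = p31_2 n f + des n f := by
  have : p2_31 n f = 0 := by
    rw [p2_31, card_eq_zero, filter_eq_empty_iff]
    rintro ⟨i, j⟩ _ ⟨h1, h2, h3, h4⟩
    exact h ⟨i, j, j + 1, h1, by omega, h2, h3, h4⟩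
  rw [mad, this]; omega

theorem sist_eq (n : ℕ) (f : ℕ → ℕ) (h : Av132 n f) : sist12 n f = p2_13 n f + des n f := by
  have : p13_2 n f = 0 := by
    rw [p13_2, card_eq_zero, filter_eq_empty_iff]
    rintro ⟨i, j⟩ hm ⟨h1, h2, h3⟩
    simp only [mem_product, mem_range] at hm
    exact h ⟨i, i + 1, j, by omega, h1, hm.2, h2, h3⟩
  rw [sist12, this]; omega

theorem av_rev (n : ℕ) (f g : ℕ → ℕ) (hg : ∀ i < n, g i = f (n - 1 - i))
    (h : Av132 n f) : Av231 n g := by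
  rintro ⟨i, j, k, h1, h2, h3, h4, h5⟩
  rw [hg i (by omega), hg j (by omega)] at *
  rw [hg k h3] at h4
  exact h ⟨n - 1 - k, n - 1 - j, n - 1 - i, by omega, by omega, by omega, h4, h5⟩

theorem av_rev' (n : ℕ) (f g : ℕ → ℕ) (hg : ∀ i < n, g i = f (n - 1 - i))
    (h : Av231 n f) : Av132 n g := by
  rintro ⟨i, j, k, h1, h2, h3, h4, h5⟩
  rw [hg i (by omega), hg k (by omega)] at h4
  rw [hg j (by omega), hg k (by omega)] at h5
  exact h ⟨n - 1 - k, n - 1 - j, n - 1 - i, by omega, by omega, by omega, h4, h5⟩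

theorem des_rev (n : ℕ) (f g : ℕ → ℕ) (hg : ∀ i < n, g i = f (n - 1 - i)) :
    des n f = ascn n g := by
  rw [des, desSet, ascn]
  refine card_bij' (fun i _ => n - 2 - i) (fun i _ => n - 2 - i) ?_ ?_ ?_ ?_
  · intro i hi
    simp only [mem_filter, mem_range] at *
    rw [hg _ (by omega), hg _ (by omega)]
    rw [show n - 1 - (n - 2 - i) = i + 1 by omega, show n - 1 - (n - 2 - i + 1) = i by omega]
    omega
  · intro i hi
    simp only [mem_filter, mem_range] at *
    rw [hg _ (by omega), hg _ (by omega)] at hi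
    rw [show n - 2 - i + 1 = n - 1 - i by omega, show n - 2 - i = n - 1 - (i + 1) by omega]
    omega
  · intro i hi
    simp only [mem_filter, mem_range] at hi
    omega
  · intro i hi
    simp only [mem_filter, mem_range] at hi
    omega

theorem occ_rev (n : ℕ) (f g : ℕ → ℕ) (hg : ∀ i < n, g i = f (n - 1 - i)) :
    p2_13 n f = p31_2 n g := by
  rw [p2_13, p31_2]
  refine card_bij' (fun p _ => (n - 2 - p.2, n - 1 - p.1)) (fun p _ => (n - 1 - p.2, n - 2 - p.1))
    ?_ ?_ ?_ ?_
  · rintro ⟨i, j⟩ hi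
    simp only [mem_filter, mem_range, mem_product] at *
    rw [hg _ (by omega), hg _ (by omega), hg _ (by omega)]
    rw [show n - 1 - (n - 2 - j) = j + 1 by omega, show n - 1 - (n - 2 - j + 1) = j by omega,
      show n - 1 - (n - 1 - i) = i by omega]
    omega
  · rintro ⟨i, j⟩ hi
    simp only [mem_filter, mem_range, mem_product] at *
    rw [hg _ (by omega), hg _ (by omega), hg _ (by omega)] at hi
    rw [show n - 2 - i + 1 = n - 1 - i by omega, show n - 2 - i = n - 1 - (i + 1) by omega]
    omega
  · rintro ⟨i, j⟩ hi
    simp only [mem_filter, mem_range, mem_product, Prod.mk.injEq] at *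
    omega
  · rintro ⟨i, j⟩ hi
    simp only [mem_filter, mem_range, mem_product, Prod.mk.injEq] at *
    omega

def rv {n : ℕ} (σ : Equiv.Perm (Fin n)) : Equiv.Perm (Fin n) := Fin.revPerm.trans σ

theorem rv_rv {n : ℕ} (σ : Equiv.Perm (Fin n)) : rv (rv σ) = σ := by
  ext i; simp [rv]

theorem pf_rv {n : ℕ} (σ : Equiv.Perm (Fin n)) : ∀ i < n, pf (rv σ) i = pf σ (n - 1 - i) := by
  intro i hi
  have h2 : n - 1 - i < n := by omega
  simp only [pf, hi, h2, dif_pos, rv, Equiv.trans_apply, Fin.revPerm_apply]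
  congr 3
  apply Fin.ext
  simp only [Fin.val_rev]; omega

/-- `mad` over `S_n(231)` is equidistributed with `2·(13-2)+(2-13)+des`
over `S_n(132)`. -/
theorem stmt16 (n : ℕ) (hn : 1 ≤ n) (k : ℕ) :
    Set.ncard {σ : Equiv.Perm (Fin n) | Av231 n (pf σ) ∧ mad n (pf σ) = k} =
    Set.ncard {σ : Equiv.Perm (Fin n) | Av132 n (pf σ) ∧ sist12 n (pf σ) = k} := by
  have e1 : {σ : Equiv.Perm (Fin n) | Av231 n (pf σ) ∧ mad n (pf σ) = k} =
      {σ : Equiv.Perm (Fin n) | Av231 n (pf σ) ∧ p31_2 n (pf σ) + des n (pf σ) = k} := by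
    ext σ
    simp only [Set.mem_ofPred_eq]
    refine and_congr_right fun h => ?_
    rw [mad_eq_s16 _ _ h]
  have hrv : Function.Injective (rv (n := n)) := fun a b h => by
    rw [← rv_rv a, h, rv_rv]
  have e2 : rv '' {σ : Equiv.Perm (Fin n) | Av132 n (pf σ) ∧ sist12 n (pf σ) = k} =
      {σ : Equiv.Perm (Fin n) | Av231 n (pf σ) ∧ p31_2 n (pf σ) + ascn n (pf σ) = k} := by
    ext σ
    simp only [Set.mem_image, Set.mem_ofPred_eq]
    constructor
    · rintro ⟨τ, ⟨h1, h2⟩, rfl⟩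
      rw [sist_eq _ _ h1, occ_rev n _ _ (pf_rv τ), des_rev n _ _ (pf_rv τ)] at h2
      exact ⟨av_rev n _ _ (pf_rv τ) h1, h2⟩
    · rintro ⟨h1, h2⟩
      have h3 := av_rev' n _ _ (pf_rv σ) h1
      refine ⟨rv σ, ⟨h3, ?_⟩, rv_rv σ⟩
      have h4 := pf_rv (rv σ)
      rw [rv_rv] at h4
      rw [sist_eq _ _ h3, occ_rev n _ _ h4, des_rev n _ _ h4, h2]
  rw [e1, ← Set.ncard_image_of_injective {σ : Equiv.Perm (Fin n) | Av132 n (pf σ) ∧ _} hrv, e2]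
  rw [count_trees n (fun n f => p31_2 n f + des n f) (fun T => T.oc + T.dl) (by
      intro T
      have h1 := occ_lf (T.w 1)
      have h2 := des_lf (T.w 1)
      rw [BT.w_length] at h1 h2
      simp only [h1, h2, occL_w, (desasc_w T 1).1]) k,
    count_trees n (fun n f => p31_2 n f + ascn n f) (fun T => T.oc + T.ar) (by
      intro T
      have h1 := occ_lf (T.w 1)
      have h2 := asc_lf (T.w 1)
      rw [BT.w_length] at h1 h2
      simp only [h1, h2, occL_w, (desasc_w T 1).2]) k]
  have hphi : Function.Injective BT.phi := fun a b h => by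
    rw [← BT.phi_invol a, h, BT.phi_invol]
  rw [← Set.ncard_image_of_injective {T : BT | T.size = n ∧ T.oc + T.dl = k} hphi]
  congr 1
  ext T
  simp only [Set.mem_image, Set.mem_ofPred_eq]
  constructor
  · rintro ⟨T, ⟨h1, h2⟩, rfl⟩
    obtain ⟨s1, s2, s3, s4⟩ := BT.phi_stat T
    omega
  · rintro ⟨h1, h2⟩
    obtain ⟨s1, s2, s3, s4⟩ := BT.phi_stat T
    exact ⟨BT.phi T, by omega, BT.phi_invol T⟩

end MahonianStats
end
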